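/- arXiv:1512.04890 — 4 statements merged into one kernel-verified Lean document; each statement's English description precedes it below -/
import Mathlib

section
/- Let q be an odd prime power, n ≥ 1, let s be such that 2^(s+1) exactly divides q² − 1, and let r_t be the natural number with 2^(r_t) ≤ 2n < 2^(r_t+1). Let PSp_{2n}(F_q) denote the quotient of Sp_{2n}(F_q) by its center. Then exp_2(PSp_{2n}(F_q)) = 2^(s + r_t − 1) if n is not a power of 2, and exp_2(PSp_{2n}(F_q)) = 2^(s + r_t − 2) if n is a power of 2. -/
lemma exists_sign_mul_sub_one_two_adic {q s : ℕ} (hq : Odd q)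
    (hs : 2 ^ (s + 1) ∣ q ^ 2 - 1 ∧ ¬ 2 ^ (s + 2) ∣ q ^ 2 - 1) :
    2 ≤ s ∧ ∃ c : ℤ, (c = q ∨ c = -q) ∧ (2 : ℤ) ^ s ∣ c - 1 ∧ ¬ (2 : ℤ) ^ (s + 1) ∣ c - 1 := by
  have h1 : 1 ≤ q ^ 2 := Nat.one_le_pow _ _ hq.pos
  have hs' : (2 : ℤ) ^ (s + 1) ∣ (q : ℤ) ^ 2 - 1 ∧ ¬ (2 : ℤ) ^ (s + 2) ∣ (q : ℤ) ^ 2 - 1 := by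
    have e : (q : ℤ) ^ 2 - 1 = ((q ^ 2 - 1 : ℕ) : ℤ) := by push_cast [h1]; rfl
    rw [e]
    exact ⟨by exact_mod_cast hs.1, fun h => hs.2 (by exact_mod_cast h)⟩
  have hc : ∃ c : ℤ, (c = q ∨ c = -q) ∧ ∃ d, c = 4 * d + 1 := by
    obtain ⟨k, rfl⟩ := hq
    rcases Nat.even_or_odd' k with ⟨d, rfl | rfl⟩
    · exact ⟨_, Or.inl rfl, d, by push_cast; ring⟩
    · exact ⟨_, Or.inr rfl, -d - 1, by push_cast; ring⟩
  obtain ⟨c, hcq, d, hd⟩ := hc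
  have hsq : (q : ℤ) ^ 2 - 1 = 2 * ((c - 1) * (2 * d + 1)) := by
    have : (q : ℤ) ^ 2 = c ^ 2 := by rcases hcq with rfl | rfl <;> ring
    rw [this, hd]; ring
  have hcop : ∀ k, IsCoprime ((2 : ℤ) ^ k) (2 * d + 1) := fun k =>
    IsCoprime.pow_left ⟨-d, 1, by ring⟩
  have key : ∀ k, (2 : ℤ) ^ (k + 1) ∣ (q : ℤ) ^ 2 - 1 ↔ (2 : ℤ) ^ k ∣ c - 1 := fun k => by
    rw [hsq, pow_succ', mul_dvd_mul_iff_left two_ne_zero]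
    exact ⟨(hcop k).dvd_of_dvd_mul_right, fun h => h.mul_right _⟩
  rw [key, key] at hs'
  refine ⟨?_, c, hcq, hs'⟩
  by_contra! hlt
  refine hs'.2 ((pow_dvd_pow 2 (show s + 1 ≤ 2 by omega)).trans ⟨d, ?_⟩)
  rw [hd]; ring

lemma two_pow_dvd_of_dvd_pow_sub_one {c : ℤ} {s m n : ℕ} (hs : 2 ≤ s)
    (h1 : (2 : ℤ) ^ s ∣ c - 1) (h2 : ¬ (2 : ℤ) ^ (s + 1) ∣ c - 1)
    (hm : s ≤ m) (h : (2 : ℤ) ^ m ∣ c ^ n - 1) : 2 ^ (m - s) ∣ n := by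
  have h4 : (4 : ℤ) ∣ c - 1 := (pow_dvd_pow 2 hs).trans h1
  have hodd : ¬ (2 : ℤ) ∣ c := by omega
  have := Int.two_pow_sub_pow' n h4 hodd
  rw [one_pow, emultiplicity_eq_coe.mpr ⟨h1, h2⟩] at this
  have h3 := le_emultiplicity_of_pow_dvd h
  rw [this] at h3
  have h5 : ((m - s : ℕ) : ℕ∞) ≤ emultiplicity (2 : ℤ) n := by
    obtain ⟨t, rfl⟩ := Nat.exists_eq_add_of_le hm
    rw [Nat.add_sub_cancel_left]
    push_cast at h3
    exact (ENat.add_le_add_iff_left (ENat.natCast_ne_top s)).mp h3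
  exact_mod_cast pow_dvd_of_le_emultiplicity h5

lemma two_pow_le_ncard_of_inv_mem_of_pow_mem {G : Type*} [Group G] {q s m : ℕ} (hq : Odd q)
    (hs : 2 ^ (s + 1) ∣ q ^ 2 - 1 ∧ ¬ 2 ^ (s + 2) ∣ q ^ 2 - 1) {T : Set G} (hT : T.Finite)
    (hinv : ∀ g ∈ T, g⁻¹ ∈ T) (hpow : ∀ g ∈ T, g ^ q ∈ T) {g : G} (hg : g ∈ T)
    (hord : orderOf g = 2 ^ m) (hm : s ≤ m) : 2 ^ (m - s + 1) ≤ T.ncard := by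
  obtain ⟨hs2, c, hcq, h1, h2⟩ := exists_sign_mul_sub_one_two_adic hq hs
  have h4 : (4 : ℤ) ∣ c - 1 := (pow_dvd_pow 2 hs2).trans h1
  have h4pow : ∀ i : ℕ, (4 : ℤ) ∣ c ^ i - 1 := fun i => by
    simpa using h4.trans (sub_dvd_pow_sub_pow c 1 i)
  have h4m : (4 : ℤ) ∣ 2 ^ m := pow_dvd_pow 2 (hs2.trans hm)
  have hmem : ∀ i : ℕ, g ^ (c ^ i) ∈ T := fun i => by
    induction i with
    | zero => simpa using hg
    | succ i ih =>
      rw [pow_succ, zpow_mul]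
      rcases hcq with rfl | rfl
      · simpa using hpow _ ih
      · simpa using hinv _ (hpow _ ih)
  have hcancel : ∀ i j : ℕ, i ≤ j → j < 2 ^ (m - s) → (2 : ℤ) ^ m ∣ c ^ i - c ^ j → i = j := by
    intro i j hij hj h
    obtain ⟨t, rfl⟩ := Nat.exists_eq_add_of_le hij
    have hcop : IsCoprime ((2 : ℤ) ^ m) (c ^ i) := by
      obtain ⟨d, hd⟩ := h4
      exact IsCoprime.pow ⟨-(2 * d), 1, by linear_combination hd⟩
    have h' : (2 : ℤ) ^ m ∣ c ^ t - 1 := by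
      refine hcop.dvd_of_dvd_mul_left ?_
      obtain ⟨d, hd⟩ := h
      exact ⟨-d, by linear_combination -hd⟩
    have := Nat.eq_zero_of_dvd_of_lt (two_pow_dvd_of_dvd_pow_sub_one hs2 h1 h2 hm h') (by omega)
    omega
  have hinj : ∀ i j : ℕ, i < 2 ^ (m - s) → j < 2 ^ (m - s) →
      (2 : ℤ) ^ m ∣ c ^ i - c ^ j → i = j := by
    intro i j hi hj h
    rcases le_total i j with hij | hij
    · exact hcancel i j hij hj h
    · exact (hcancel j i hij hi ((dvd_sub_comm).mp h)).symm
  have heq : ∀ a b : ℤ, g ^ a = g ^ b ↔ (2 : ℤ) ^ m ∣ a - b := fun a b => by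
    rw [zpow_eq_zpow_iff_modEq, hord, Int.modEq_comm, Int.modEq_iff_dvd]
    push_cast
    rfl
  let f : Fin (2 ^ (m - s)) ⊕ Fin (2 ^ (m - s)) → T :=
    Sum.elim (fun i => ⟨_, hmem i⟩) (fun i => ⟨_, hinv _ (hmem i)⟩)
  have hf : Function.Injective f := by
    rintro (i | i) (j | j) h <;>
      simp only [f, Sum.elim_inl, Sum.elim_inr, Subtype.mk.injEq, ← zpow_neg, heq] at h
    · exact congrArg _ (Fin.ext (hinj _ _ i.2 j.2 h))
    · have := h4m.trans h
      have := h4pow i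
      have := h4pow j
      omega
    · have := h4m.trans h
      have := h4pow i
      have := h4pow j
      omega
    · refine congrArg _ (Fin.ext (hinj _ _ i.2 j.2 ?_))
      obtain ⟨d, hd⟩ := h
      exact ⟨-d, by linear_combination -hd⟩
  have := hT.to_subtype
  have := Nat.card_le_card_of_injective f hf
  rw [Nat.card_coe_set_eq, Nat.card_sum, Nat.card_fin] at this
  rw [pow_succ]
  omega

open Polynomial in
lemma aeval_eq_zero_of_isCoprime_of_spectrum {K A : Type*} [Field K] [IsAlgClosed K] [Ring A]
    [Algebra K A] {a : A} {P Q : K[X]} (hPQ : IsCoprime P Q) (h : aeval a (P * Q) = 0)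
    (hspec : ∀ μ ∈ spectrum K a, P.eval μ = 0) (hne : (spectrum K a).Nonempty) :
    aeval a P = 0 := by
  have hu : IsUnit (aeval a Q) := by
    rw [← spectrum.zero_notMem_iff K, spectrum.map_polynomial_aeval_of_nonempty a Q hne]
    rintro ⟨μ, hμ, hQ⟩
    obtain ⟨u, v, huv⟩ := hPQ
    have := congrArg (eval μ) huv
    simp only [eval_add, eval_mul, hspec μ hμ, eval_one] at this
    simp_all
  rw [map_mul] at h
  exact (hu.mul_left_eq_zero).mp h

open Polynomial in
lemma pow_eq_of_spectrum {K A : Type*} [Field K] [IsAlgClosed K] (h2 : (2 : K) ≠ 0) [Ring A]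
    [Algebra K A] {a : A} {M e : ℕ} (he : e < M) (h : a ^ 2 ^ M = 1) {ε : K} (hε : ε ^ 2 = 1)
    (hspec : ∀ μ ∈ spectrum K a, μ ^ 2 ^ e = ε) (hne : (spectrum K a).Nonempty) :
    a ^ 2 ^ e = algebraMap K A ε := by
  have hdvd : (X ^ 2 ^ e - C ε : K[X]) ∣ X ^ 2 ^ M - 1 := by
    obtain ⟨t, rfl⟩ := Nat.exists_eq_add_of_lt he
    have h1 : (C ε : K[X]) ^ 2 ^ (t + 1) = 1 := by
      rw [← C_pow, pow_succ', pow_mul, hε, one_pow, C_1]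
    rw [add_assoc, pow_add 2 e, pow_mul, ← h1]
    exact sub_dvd_pow_sub_pow _ _ _
  obtain ⟨Q, hQ⟩ := hdvd
  have hsep : (X ^ 2 ^ M - 1 : K[X]).Separable :=
    X_pow_sub_one_separable_iff.mpr (by push_cast; exact pow_ne_zero _ h2)
  rw [hQ] at hsep
  have := aeval_eq_zero_of_isCoprime_of_spectrum (a := a) hsep.isCoprime (by simp [← hQ, h])
    (fun μ hμ => by simp [hspec μ hμ]) hne
  simpa [sub_eq_zero] using this

open Matrix in
lemma SymplecticGroup.charpoly_inv {l R : Type*} [DecidableEq l] [Fintype l] [CommRing R]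
    (A : symplecticGroup l R) :
    (↑A⁻¹ : Matrix (l ⊕ l) (l ⊕ l) R).charpoly = (A : Matrix (l ⊕ l) (l ⊕ l) R).charpoly := by
  rw [SymplecticGroup.coe_inv, charpoly_mul_comm, ← mul_assoc, mul_neg, J_squared, neg_neg,
    one_mul, charpoly_transpose]

open Polynomial in
lemma FiniteField.isRoot_map_pow_card {F K : Type*} [Field F] [Fintype F] [Field K] [Algebra F K]
    (p : F[X]) {μ : K} (h : (p.map (algebraMap F K)).IsRoot μ) :
    (p.map (algebraMap F K)).IsRoot (μ ^ Fintype.card F) := by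
  rw [IsRoot, eval_map_algebraMap] at h ⊢
  rw [← expand_aeval, FiniteField.expand_card, map_pow, h, zero_pow Fintype.card_ne_zero]

section Spectrum

open Matrix

variable {F K : Type*} [Field F] [Fintype F] [Field K] [Algebra F K] {l : Type*} [DecidableEq l]
  [Fintype l]

lemma SymplecticGroup.inv_mem_spectrum (A : symplecticGroup l K) (u : Kˣ)
    (hu : (u : K) ∈ spectrum K (A : Matrix (l ⊕ l) (l ⊕ l) K)) :
    ((u⁻¹ : Kˣ) : K) ∈ spectrum K (A : Matrix (l ⊕ l) (l ⊕ l) K) := by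
  let a : (Matrix (l ⊕ l) (l ⊕ l) K)ˣ :=
    ⟨A, ↑A⁻¹, congrArg Subtype.val (mul_inv_cancel A), congrArg Subtype.val (inv_mul_cancel A)⟩
  have := (spectrum.inv_mem_iff (a := a)).mp hu
  rw [mem_spectrum_iff_isRoot_charpoly] at this ⊢
  rwa [← SymplecticGroup.charpoly_inv]

lemma Matrix.pow_card_mem_spectrum_map (A : Matrix l l F) {μ : K}
    (hμ : μ ∈ spectrum K (A.map (algebraMap F K))) :
    μ ^ Fintype.card F ∈ spectrum K (A.map (algebraMap F K)) := by
  rw [mem_spectrum_iff_isRoot_charpoly, charpoly_map] at *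
  exact FiniteField.isRoot_map_pow_card _ hμ

lemma Matrix.ncard_spectrum_le (A : Matrix l l K) : (spectrum K A).ncard ≤ Fintype.card l := by
  have : spectrum K A = A.charpoly.rootSet K := by
    ext μ
    rw [mem_spectrum_iff_isRoot_charpoly, Polynomial.mem_rootSet_of_ne A.charpoly_monic.ne_zero]
    simp [Polynomial.IsRoot]
  rw [this, ← A.charpoly_natDegree_eq_dim]
  exact Polynomial.ncard_rootSet_le _ _

lemma spectrum_pow_eq_one {R A : Type*} [Field R] [Ring A] [Algebra R A] {a : A} {N : ℕ}
    (h : a ^ N = 1) {μ : R} (hμ : μ ∈ spectrum R a) : μ ^ N = 1 := by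
  have := spectrum.pow_mem_pow a N hμ
  have hn : Nontrivial A := by
    by_contra hA
    rw [not_nontrivial_iff_subsingleton] at hA
    simp [spectrum.of_subsingleton] at hμ
  rw [h, spectrum.one_eq] at this
  exact this

end Spectrum

lemma FiniteField.two_ne_zero_of_odd_card {F K : Type*} [Field F] [Fintype F] [Field K]
    [Algebra F K] (hq : Odd (Fintype.card F)) : (2 : K) ≠ 0 := by
  have h2F : (2 : F) ≠ 0 := by
    intro h
    have h2 : ringChar F = 2 := by
      have := ringChar.dvd (R := F) (x := 2) (by exact_mod_cast h)
      exact ((Nat.dvd_prime Nat.prime_two).mp this).resolve_left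
        (CharP.ringChar_ne_one (R := F))
    have := FiniteField.even_card_of_char_two h2
    rw [Nat.odd_iff] at hq
    omega
  have := (map_ne_zero (algebraMap F K)).mpr h2F
  rwa [map_ofNat] at this

lemma Matrix.map_algebraMap_pow_eq {F K l : Type*} [Field F] [Field K] [Algebra F K] [DecidableEq l]
    [Fintype l] (A : Matrix l l F) {N : ℕ}
    {ε : F} (h : A.map (algebraMap F K) ^ N = algebraMap K _ (algebraMap F K ε)) :
    A ^ N = algebraMap F _ ε := by
  apply Matrix.map_injective (algebraMap F K).injective
  have := Matrix.map_pow A (algebraMap F K) N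
  beta_reduce
  rw [this, h, Matrix.algebraMap_eq_diagonal, Matrix.algebraMap_eq_diagonal]
  simp [Matrix.diagonal_map]

section UpperBound

open Matrix

variable {F : Type*} [Field F] [Fintype F] {l : Type*} [DecidableEq l] [Fintype l]

lemma SymplecticGroup.two_pow_le_ncard_spectrum {K : Type*} [Field K] [Algebra F K] {s m : ℕ}
    (hq : Odd (Fintype.card F))
    (hs : 2 ^ (s + 1) ∣ Fintype.card F ^ 2 - 1 ∧ ¬ 2 ^ (s + 2) ∣ Fintype.card F ^ 2 - 1)
    {A : Matrix (l ⊕ l) (l ⊕ l) F} (hA : A ∈ symplecticGroup l F) {u : Kˣ}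
    (hu : (u : K) ∈ spectrum K (A.map (algebraMap F K))) (hord : orderOf u = 2 ^ (m + 1))
    (hm : s ≤ m + 1) :
    2 ^ (m + 1 - s + 1) ≤
      {μ ∈ spectrum K (A.map (algebraMap F K)) | μ ^ 2 ^ m = -1}.ncard := by
  set B := A.map (algebraMap F K)
  have hB : B ∈ symplecticGroup l K := SymplecticGroup.map_mem hA _
  have hfin : {μ ∈ spectrum K B | μ ^ 2 ^ m = -1}.Finite :=
    (Matrix.finite_spectrum B).subset (Set.sep_subset _ _)
  let T : Set Kˣ := {v | (v : K) ∈ spectrum K B ∧ v ^ 2 ^ m = -1}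
  have hmaps : ∀ v ∈ T, (v : K) ∈ {μ ∈ spectrum K B | μ ^ 2 ^ m = -1} := fun v hv =>
    ⟨hv.1, by simpa using congrArg Units.val hv.2⟩
  have hinj : Set.InjOn (Units.val : Kˣ → K) T := Units.val_injective.injOn
  have huT : u ∈ T := by
    refine ⟨hu, ?_⟩
    have h1 : (u ^ 2 ^ m) ^ 2 = 1 := by rw [← pow_mul, ← pow_succ, ← hord, pow_orderOf_eq_one]
    have h2 : u ^ 2 ^ m ≠ 1 := fun h => by
      have := Nat.le_of_dvd (by positivity) (hord ▸ orderOf_dvd_of_pow_eq_one h)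
      rw [pow_succ] at this
      have : 0 < 2 ^ m := by positivity
      omega
    have h3 : ((u ^ 2 ^ m : Kˣ) : K) ^ 2 = 1 := by
      rw [← Units.val_pow_eq_pow_val, h1, Units.val_one]
    rcases sq_eq_one_iff.mp h3 with h | h
    · exact absurd (Units.ext h) h2
    · exact Units.ext h
  calc 2 ^ (m + 1 - s + 1) ≤ T.ncard := by
        refine two_pow_le_ncard_of_inv_mem_of_pow_mem hq hs
          (Set.Finite.of_injOn hmaps hinj hfin) ?_ ?_ huT hord hm
        · rintro v ⟨hv, hv'⟩
          exact ⟨SymplecticGroup.inv_mem_spectrum ⟨B, hB⟩ v hv, by rw [inv_pow, hv', inv_neg_one]⟩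
        · rintro v ⟨hv, hv'⟩
          refine ⟨?_, by rw [pow_right_comm, hv', hq.neg_one_pow]⟩
          rw [Units.val_pow_eq_pow_val]
          exact Matrix.pow_card_mem_spectrum_map A hv
    _ ≤ _ := Set.ncard_le_ncard_of_injOn _ hmaps hinj hfin

lemma SymplecticGroup.pow_two_pow_eq [Nonempty l] {s r M : ℕ} (hq : Odd (Fintype.card F))
    (hs : 2 ^ (s + 1) ∣ Fintype.card F ^ 2 - 1 ∧ ¬ 2 ^ (s + 2) ∣ Fintype.card F ^ 2 - 1)
    (hl : 2 * Fintype.card l < 2 ^ (r + 1)) {A : Matrix (l ⊕ l) (l ⊕ l) F}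
    (hA : A ∈ symplecticGroup l F) (hM : A ^ 2 ^ M = 1) :
    A ^ 2 ^ (s + r - 1) = 1 ∧
      (2 * Fintype.card l = 2 ^ r → A ^ 2 ^ (s + r - 2) = 1 ∨ A ^ 2 ^ (s + r - 2) = -1) := by
  obtain ⟨hs2, -⟩ := exists_sign_mul_sub_one_two_adic hq hs
  have hlpos : 0 < Fintype.card l := Fintype.card_pos
  have hr : 1 ≤ r := by
    by_contra! h
    obtain rfl : r = 0 := by omega
    omega
  let K := AlgebraicClosure F
  set B := A.map (algebraMap F K) with hBdef
  have hBM : B ^ 2 ^ M = 1 := by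
    rw [hBdef, ← Matrix.map_pow, hM, Matrix.map_one _ (map_zero _) (map_one _)]
  have h2K : (2 : K) ≠ 0 := FiniteField.two_ne_zero_of_odd_card hq
  have hne : (spectrum K B).Nonempty :=
    spectrum.nonempty_of_isAlgClosed_of_finiteDimensional K B
  have hcard : (spectrum K B).ncard ≤ 2 * Fintype.card l := by
    simpa [two_mul] using Matrix.ncard_spectrum_le B
  have hfin : (spectrum K B).Finite := Matrix.finite_spectrum B
  have hlarge : ∀ μ ∈ spectrum K B, ∀ e, s ≤ e + 1 → μ ^ 2 ^ e ≠ 1 →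
      ∃ m, e ≤ m ∧ 2 ^ (m + 1 - s + 1) ≤ {μ ∈ spectrum K B | μ ^ 2 ^ m = -1}.ncard := by
    intro μ hμ e he hne1
    have hμM := spectrum_pow_eq_one hBM hμ
    let u : Kˣ := Units.ofPowEqOne μ _ hμM (by positivity)
    have hu : ∀ N, u ^ N = 1 ↔ μ ^ N = 1 := fun N => by
      rw [← Units.val_inj, Units.val_pow_eq_pow_val]; rfl
    obtain ⟨j, -, hj⟩ := (Nat.dvd_prime_pow Nat.prime_two).mp
      (orderOf_dvd_of_pow_eq_one ((hu _).mpr hμM))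
    have hej : e < j := by
      by_contra! hle
      exact hne1 ((hu _).mp (orderOf_dvd_iff_pow_eq_one.mp (hj ▸ pow_dvd_pow 2 hle)))
    obtain ⟨m, rfl⟩ : ∃ m, j = m + 1 := ⟨j - 1, by omega⟩
    exact ⟨m, by omega, SymplecticGroup.two_pow_le_ncard_spectrum hq hs hA (u := u) hμ hj
      (by omega)⟩
  have hsep : ∀ m, {μ ∈ spectrum K B | μ ^ 2 ^ m = -1}.ncard ≤ 2 * Fintype.card l := fun m =>
    (Set.ncard_le_ncard (Set.sep_subset _ _) hfin).trans hcard
  have hone : ∀ e, (∀ μ ∈ spectrum K B, μ ^ 2 ^ e = 1) → A ^ 2 ^ e = 1 := fun e h => by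
    have := pow_eq_of_spectrum h2K (M := M + e + 1) (e := e) (by omega)
      (by rw [add_assoc, pow_add, pow_mul, hBM, one_pow]) (one_pow 2) h hne
    rw [← map_one (algebraMap F K)] at this
    simpa using Matrix.map_algebraMap_pow_eq A this
  have hneg : ∀ e, (∀ μ ∈ spectrum K B, μ ^ 2 ^ e = -1) → A ^ 2 ^ e = -1 := fun e h => by
    have := pow_eq_of_spectrum h2K (M := M + e + 1) (e := e) (by omega)
      (by rw [add_assoc, pow_add, pow_mul, hBM, one_pow]) neg_one_sq h hne
    rw [← map_one (algebraMap F K), ← map_neg] at this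
    simpa using Matrix.map_algebraMap_pow_eq A this
  refine ⟨hone _ fun μ hμ => ?_, fun hcard2 => ?_⟩
  · by_contra hne1
    obtain ⟨m, hm, hle⟩ := hlarge μ hμ _ (by omega) hne1
    have := (Nat.pow_lt_pow_iff_right (by norm_num)).mp ((hle.trans (hsep m)).trans_lt hl)
    omega
  · by_cases hall : ∀ μ ∈ spectrum K B, μ ^ 2 ^ (s + r - 2) = 1
    · exact Or.inl (hone _ hall)
    · right
      push Not at hall
      obtain ⟨μ, hμ, hne1⟩ := hall
      obtain ⟨m, hm, hle⟩ := hlarge μ hμ _ (by omega) hne1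
      have := (Nat.pow_lt_pow_iff_right (by norm_num)).mp ((hle.trans (hsep m)).trans_lt hl)
      obtain rfl : m = s + r - 2 := by omega
      rw [show s + r - 2 + 1 - s + 1 = r by omega, ← hcard2] at hle
      have := Set.eq_of_subset_of_ncard_le (Set.sep_subset _ _) (hcard.trans hle) hfin
      exact hneg _ fun ν hν => (this.ge hν).2

end UpperBound

lemma Matrix.fromBlocks_neg_one {l m R : Type*} [CommRing R] [DecidableEq l] [DecidableEq m] :
    fromBlocks (-1) 0 0 (-1) = (-1 : Matrix (l ⊕ m) (l ⊕ m) R) := by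
  rw [← fromBlocks_one, fromBlocks_neg, neg_zero, neg_zero]

section Center

open Matrix

variable {F : Type*} [Field F] {l : Type*} [DecidableEq l] [Fintype l]

lemma Matrix.mem_range_scalar_of_commute_isSymm {A : Matrix l l F}
    (h : ∀ S : Matrix l l F, S.IsSymm → Commute S A) : A ∈ Set.range (scalar l) := by
  refine mem_range_scalar_of_commute_single fun i j hij => ?_
  have h1 : Commute (single i i (1 : F)) A := h _ (by simp [IsSymm])
  have h2 : Commute (single i j (1 : F) + single j i 1) A :=
    h _ (by simp [IsSymm, add_comm])
  have := h1.mul_left h2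
  simpa [mul_add, hij] using this

lemma SymplecticGroup.coe_eq_one_or_neg_one_of_mem_center {g : symplecticGroup l F}
    (hg : g ∈ Subgroup.center (symplecticGroup l F)) :
    (g : Matrix (l ⊕ l) (l ⊕ l) F) = 1 ∨ (g : Matrix (l ⊕ l) (l ⊕ l) F) = -1 := by
  obtain ⟨M, hM⟩ := g
  rw [Subgroup.mem_center_iff] at hg
  replace hg : ∀ N ∈ symplecticGroup l F, N * M = M * N := fun N hN =>
    congrArg Subtype.val (hg ⟨N, hN⟩)
  obtain ⟨A, B, C, D, rfl⟩ : ∃ A B C D, M = fromBlocks A B C D :=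
    ⟨_, _, _, _, (fromBlocks_toBlocks M).symm⟩
  have hup : ∀ S : Matrix l l F, S.IsSymm →
      fromBlocks 1 S 0 1 * fromBlocks A B C D = fromBlocks A B C D * fromBlocks 1 S 0 1 :=
    fun S hS => hg _ (by rw [SymplecticGroup.fromBlocks_mem_iff]; simp [hS.eq])
  have hlow : fromBlocks 1 0 1 1 * fromBlocks A B C D =
      fromBlocks A B C D * fromBlocks 1 0 1 1 :=
    hg _ (by rw [SymplecticGroup.fromBlocks_mem_iff]; simp)
  simp only [fromBlocks_multiply, fromBlocks_inj, one_mul, mul_one, zero_mul, mul_zero, add_zero,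
    zero_add] at hup hlow
  have hB : B = 0 := by simpa using hlow.1
  have hC : C = 0 := by simpa using (hup 1 isSymm_one).1
  have hD : D = A := by simpa [hB, hC] using (hup 1 isSymm_one).2.1
  subst hB hC hD
  obtain ⟨c, rfl⟩ := Matrix.mem_range_scalar_of_commute_isSymm (A := D) fun S hS => by
    simpa [Commute, SemiconjBy] using (hup S hS).2.1
  cases isEmpty_or_nonempty l
  · exact Or.inl (Subsingleton.elim _ _)
  · have h1 := (SymplecticGroup.fromBlocks_mem_iff.mp hM).2.2
    obtain ⟨i⟩ := ‹Nonempty l›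
    have h2 : c * c = 1 := by simpa using congrFun (congrFun h1 i) i
    rcases mul_self_eq_one_iff.mp h2 with rfl | rfl
    · left; simp
    · right
      change fromBlocks _ _ _ _ = _
      rw [map_neg, map_one, fromBlocks_neg_one]

lemma SymplecticGroup.mem_center_of_coe_eq {g : symplecticGroup l F}
    (hg : (g : Matrix (l ⊕ l) (l ⊕ l) F) = 1 ∨ (g : Matrix (l ⊕ l) (l ⊕ l) F) = -1) :
    g ∈ Subgroup.center (symplecticGroup l F) := by
  rw [Subgroup.mem_center_iff]
  intro h
  apply Subtype.ext
  rcases hg with hg | hg <;> simp [hg]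

end Center

section Exponent

variable {G : Type*} [Group G] {Z : Subgroup G} [Z.Normal]

lemma QuotientGroup.two_pow_dvd_exponent {g : G} {e : ℕ} (h1 : g ^ 2 ^ e ∉ Z)
    (h2 : g ^ 2 ^ (e + 1) ∈ Z) : 2 ^ (e + 1) ∣ Monoid.exponent (G ⧸ Z) := by
  have : orderOf (g : G ⧸ Z) = 2 ^ (e + 1) := by
    apply orderOf_eq_prime_pow
    · rwa [← QuotientGroup.mk_pow, QuotientGroup.eq_one_iff]
    · rwa [← QuotientGroup.mk_pow, QuotientGroup.eq_one_iff]
  exact this ▸ Monoid.order_dvd_exponent _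

lemma QuotientGroup.not_two_pow_dvd_exponent [Finite G] {e : ℕ}
    (h : ∀ (g : G) (M : ℕ), g ^ 2 ^ M = 1 → g ^ 2 ^ e ∈ Z) :
    ¬ 2 ^ (e + 1) ∣ Monoid.exponent (G ⧸ Z) := by
  intro hdvd
  obtain ⟨x, hx⟩ := Nat.prime_two.exists_orderOf_eq_pow_factorization_exponent (G ⧸ Z)
  have hle : 2 ^ (e + 1) ∣ orderOf x := by
    rw [hx]
    refine pow_dvd_pow 2 ?_
    exact (Nat.prime_two.pow_dvd_iff_le_factorization
      (Monoid.exponent_ne_zero_of_finite)).mp hdvd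
  obtain ⟨g, rfl⟩ := QuotientGroup.mk_surjective x
  obtain ⟨a, b, hb, hab⟩ := Nat.exists_eq_two_pow_mul_odd (orderOf_pos g).ne'
  have hg := h (g ^ b) a (by rw [← pow_mul, mul_comm, ← hab, pow_orderOf_eq_one])
  rw [← pow_mul, ← QuotientGroup.eq_one_iff, QuotientGroup.mk_pow] at hg
  have h1 := hle.trans (orderOf_dvd_of_pow_eq_one hg)
  have hcop : Nat.Coprime (2 ^ (e + 1)) b := (Nat.coprime_two_left.mpr hb).pow_left _
  exact absurd (Nat.le_of_dvd (by positivity) (hcop.dvd_of_dvd_mul_left h1))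
    (by rw [pow_succ]; have : 0 < 2 ^ e := by positivity
        omega)

end Exponent

section TwoElements

open Polynomial in
lemma FiniteField.mem_range_algebraMap_of_pow_card_eq {F K : Type*} [Field F] [Fintype F]
    [Field K] [Algebra F K] {x : K} (hx : x ^ Fintype.card F = x) :
    x ∈ Set.range (algebraMap F K) := by
  have h0 : (X ^ Fintype.card F - X : F[X]) ≠ 0 :=
    FiniteField.X_pow_card_sub_X_ne_zero F Fintype.one_lt_card
  have hroots : (X ^ Fintype.card F - X : F[X]).roots.card =
      (X ^ Fintype.card F - X : F[X]).natDegree := by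
    rw [FiniteField.roots_X_pow_card_sub_X, FiniteField.X_pow_card_sub_X_natDegree_eq F
      Fintype.one_lt_card]
    rfl
  have hx' : x ∈ ((X ^ Fintype.card F - X : F[X]).map (algebraMap F K)).roots := by
    rw [mem_roots (Polynomial.map_ne_zero h0)]
    simp [hx]
  rw [(splits_iff_card_roots.mpr hroots).roots_map] at hx'
  obtain ⟨a, -, ha⟩ := Multiset.mem_map.mp hx'
  exact ⟨a, ha⟩

open Polynomial in
lemma FiniteField.exists_quadratic_dvd_X_pow_two_pow_add_one {F : Type*} [Field F] [Fintype F]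
    {s : ℕ} (hq : Odd (Fintype.card F))
    (hs : 2 ^ (s + 1) ∣ Fintype.card F ^ 2 - 1 ∧ ¬ 2 ^ (s + 2) ∣ Fintype.card F ^ 2 - 1) :
    ∃ t : F, (X ^ 2 - C t * X + 1 : F[X]) ∣ X ^ 2 ^ (s - 1) + 1 := by
  obtain ⟨hs2, c, hc, hc1, -⟩ := exists_sign_mul_sub_one_two_adic hq hs
  let K := AlgebraicClosure F
  have h2K : (2 : K) ≠ 0 := FiniteField.two_ne_zero_of_odd_card hq
  obtain ⟨x, hx⟩ := IsAlgClosed.exists_pow_nat_eq (-1 : K) (n := 2 ^ (s - 1)) (by positivity)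
  have hx0 : x ≠ 0 := by
    rintro rfl
    rw [zero_pow (by positivity)] at hx
    exact (neg_ne_zero.mpr one_ne_zero) hx.symm
  have hxinv : x⁻¹ ^ 2 ^ (s - 1) = -1 := by rw [inv_pow, hx, inv_neg_one]
  have hne : x ≠ x⁻¹ := by
    intro h
    have h1 : x ^ 2 = 1 := by rw [pow_two]; nth_rw 2 [h]; exact mul_inv_cancel₀ hx0
    have h2 : x ^ 2 ^ (s - 1) = 1 := by
      rw [show s - 1 = s - 2 + 1 by omega, pow_succ', pow_mul, h1, one_pow]
    rw [hx] at h2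
    exact h2K (by linear_combination -h2)
  have hpow : x ^ Fintype.card F = x ∨ x ^ Fintype.card F = x⁻¹ := by
    have h1 : x ^ 2 ^ s = 1 := by
      rw [show s = s - 1 + 1 by omega, pow_succ, pow_mul, hx, neg_one_sq]
    obtain ⟨d, hd⟩ := hc1
    have h2 : x ^ c = x := by
      rw [show c = 2 ^ s * d + 1 by linear_combination hd, zpow_add_one₀ hx0, zpow_mul]
      rw [show x ^ ((2 : ℤ) ^ s) = 1 by exact_mod_cast h1, one_zpow, one_mul]
    rcases hc with rfl | rfl
    · left; simpa using h2
    · right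
      rw [zpow_neg, zpow_natCast] at h2
      rw [← h2, inv_inv]
      simp [h2]
  obtain ⟨t, ht⟩ := FiniteField.mem_range_algebraMap_of_pow_card_eq (F := F) (x := x + x⁻¹) (by
    change FiniteField.frobeniusAlgHom F K (x + x⁻¹) = _
    rw [map_add, map_inv₀]
    change x ^ Fintype.card F + (x ^ Fintype.card F)⁻¹ = _
    rcases hpow with h | h <;> rw [h]
    rw [inv_inv, add_comm])
  refine ⟨t, ?_⟩
  rw [← Polynomial.map_dvd_map' (algebraMap F K)]
  have hfac : (X ^ 2 - C t * X + 1 : F[X]).map (algebraMap F K) = (X - C x) * (X - C x⁻¹) := by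
    have : C x * C x⁻¹ = (1 : K[X]) := by rw [← C_mul, mul_inv_cancel₀ hx0, C_1]
    simp only [Polynomial.map_add, Polynomial.map_sub, Polynomial.map_pow, Polynomial.map_mul,
      map_X, map_C, Polynomial.map_one, ht, C_add]
    linear_combination -this
  rw [hfac]
  refine IsCoprime.mul_dvd (isCoprime_X_sub_C_of_isUnit_sub (sub_ne_zero.mpr hne).isUnit) ?_ ?_ <;>
    rw [dvd_iff_isRoot] <;> simp [hx, hxinv, -inv_pow]

open Matrix

lemma Matrix.reindex_mem_symplecticGroup {l l' R : Type*} [CommRing R] [DecidableEq l] [Fintype l]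
    [DecidableEq l'] [Fintype l'] (e : l ≃ l') {A : Matrix (l ⊕ l) (l ⊕ l) R}
    (hA : A ∈ symplecticGroup l R) :
    reindexAlgEquiv R R (e.sumCongr e) A ∈ symplecticGroup l' R := by
  obtain ⟨A, B, C, D, rfl⟩ : ∃ A' B' C' D', A = fromBlocks A' B' C' D' :=
    ⟨_, _, _, _, (fromBlocks_toBlocks A).symm⟩
  have : reindexAlgEquiv R R (e.sumCongr e) (fromBlocks A B C D) =
      fromBlocks (reindexAlgEquiv R R e A) (reindexAlgEquiv R R e B) (reindexAlgEquiv R R e C)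
        (reindexAlgEquiv R R e D) := by
    ext (i | i) (j | j) <;> simp
  rw [SymplecticGroup.fromBlocks_mem_iff] at hA
  rw [this, SymplecticGroup.fromBlocks_mem_iff]
  have htr : ∀ M : Matrix l l R, (reindexAlgEquiv R R e M)ᵀ = reindexAlgEquiv R R e Mᵀ :=
    fun M => by simp
  simp only [htr, ← map_mul, ← map_sub, hA, map_one, and_self]

lemma Matrix.reindex_sumSumSumComm_mem_symplecticGroup {l m R : Type*} [CommRing R]
    [DecidableEq l] [Fintype l] [DecidableEq m] [Fintype m]
    {X : Matrix ((l ⊕ l) ⊕ (m ⊕ m)) ((l ⊕ l) ⊕ (m ⊕ m)) R}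
    (hX : X * fromBlocks (J l R) 0 0 (J m R) * Xᵀ = fromBlocks (J l R) 0 0 (J m R)) :
    reindexAlgEquiv R R (Equiv.sumSumSumComm l l m m) X ∈ symplecticGroup (l ⊕ m) R := by
  have hJ : J (l ⊕ m) R =
      reindexAlgEquiv R R (Equiv.sumSumSumComm l l m m) (fromBlocks (J l R) 0 0 (J m R)) := by
    ext ((i | i) | (i | i)) ((j | j) | (j | j)) <;> simp [J, Matrix.one_apply]
  have htr : (reindexAlgEquiv R R (Equiv.sumSumSumComm l l m m) X)ᵀ =
      reindexAlgEquiv R R (Equiv.sumSumSumComm l l m m) Xᵀ := by simp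
  rw [SymplecticGroup.mem_iff, hJ, htr, ← map_mul, ← map_mul, hX]

lemma SymplecticGroup.exists_pow_eq_neg_one {R : Type*} [CommRing R] {N : ℕ}
    (h : ∀ (l : Type) [DecidableEq l] [Fintype l], ∃ A ∈ symplecticGroup l R, A ^ N = -1) (k : ℕ)
    (l : Type) [DecidableEq l] [Fintype l] (hl : Fintype.card l = 2 ^ k) :
    ∃ A ∈ symplecticGroup l R, A ^ (2 ^ k * N) = -1 := by
  induction k generalizing l with
  | zero => simpa using h l
  | succ k ih =>
    obtain ⟨A, hA, hAN⟩ := ih (Fin (2 ^ k)) (by simp)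
    let e : Fin (2 ^ k) ⊕ Fin (2 ^ k) ≃ l :=
      Fintype.equivOfCardEq (by simp [hl, pow_succ, mul_two])
    refine ⟨_, reindex_mem_symplecticGroup e
      (reindex_sumSumSumComm_mem_symplecticGroup (X := fromBlocks 0 A 1 0) ?_), ?_⟩
    · rw [SymplecticGroup.mem_iff] at hA
      simp [fromBlocks_multiply, fromBlocks_transpose, hA]
    · have hsq : fromBlocks 0 A 1 0 ^ 2 = fromBlocks A 0 0 A := by
        simp [pow_two, fromBlocks_multiply]
      rw [← map_pow, ← map_pow, pow_succ', mul_assoc, pow_mul, hsq, fromBlocks_diagonal_pow, hAN,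
        fromBlocks_neg_one, map_neg, map_neg, map_one, map_one]

lemma SymplecticGroup.exists_pow_ne_one_and_ne_neg_one {l m R : Type*} [CommRing R]
    [DecidableEq l] [Fintype l] [Nonempty l] [DecidableEq m] [Fintype m] [Nonempty m]
    (h2 : (-1 : R) ≠ 1) {N : ℕ} {A : Matrix (l ⊕ l) (l ⊕ l) R} (hA : A ∈ symplecticGroup l R)
    (hAN : A ^ N = -1) {k : Type*} [DecidableEq k] [Fintype k] (e : l ⊕ m ≃ k) :
    ∃ B ∈ symplecticGroup k R, B ^ N ≠ 1 ∧ B ^ N ≠ -1 ∧ B ^ (N * 2) = 1 := by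
  refine ⟨_, reindex_mem_symplecticGroup e
    (reindex_sumSumSumComm_mem_symplecticGroup (X := fromBlocks A 0 0 1) ?_), ?_⟩
  · rw [SymplecticGroup.mem_iff] at hA
    simp [fromBlocks_multiply, fromBlocks_transpose, hA]
  · have hpow : fromBlocks A 0 0 (1 : Matrix (m ⊕ m) (m ⊕ m) R) ^ N = fromBlocks (-1) 0 0 1 := by
      rw [fromBlocks_diagonal_pow, hAN, one_pow]
    obtain ⟨i⟩ := ‹Nonempty l›
    obtain ⟨j⟩ := ‹Nonempty m›
    rw [pow_mul, ← map_pow, ← map_pow, hpow]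
    refine ⟨?_, ?_, ?_⟩
    · rw [map_ne_one_iff _ (AlgEquiv.injective _), map_ne_one_iff _ (AlgEquiv.injective _)]
      intro h
      have := congrFun (congrFun h (Sum.inl (Sum.inl i))) (Sum.inl (Sum.inl i))
      simp at this
      exact h2 this
    · rw [← map_one (reindexAlgEquiv R R (e.sumCongr e)), ← map_neg,
        (AlgEquiv.injective _).ne_iff,
        ← map_one (reindexAlgEquiv R R (Equiv.sumSumSumComm l l m m)), ← map_neg,
        (AlgEquiv.injective _).ne_iff]
      intro h
      have := congrFun (congrFun h (Sum.inr (Sum.inl j))) (Sum.inr (Sum.inl j))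
      simp at this
      exact h2 this.symm
    · rw [← map_pow, ← map_pow, fromBlocks_diagonal_pow, neg_one_sq, one_pow, fromBlocks_one,
        map_one, map_one]

open Polynomial in
lemma SymplecticGroup.exists_pow_two_pow_eq_neg_one {F : Type*} [Field F] [Fintype F]
    {s : ℕ} (hq : Odd (Fintype.card F))
    (hs : 2 ^ (s + 1) ∣ Fintype.card F ^ 2 - 1 ∧ ¬ 2 ^ (s + 2) ∣ Fintype.card F ^ 2 - 1)
    (l : Type*) [DecidableEq l] [Fintype l] :
    ∃ A ∈ symplecticGroup l F, A ^ 2 ^ (s - 1) = -1 := by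
  obtain ⟨t, p, hp⟩ := FiniteField.exists_quadratic_dvd_X_pow_two_pow_add_one hq hs
  refine ⟨fromBlocks 0 (-1) 1 (t • 1), ?_, ?_⟩
  · rw [SymplecticGroup.fromBlocks_mem_iff]
    simp
  · have h0 : aeval (fromBlocks 0 (-1) 1 (t • 1) : Matrix (l ⊕ l) (l ⊕ l) F)
        (X ^ 2 - C t * X + 1) = 0 := by
      simp only [pow_two, map_add, map_sub, map_mul, aeval_X, map_one, aeval_C]
      rw [← Algebra.smul_def]
      simp [fromBlocks_multiply, fromBlocks_smul, fromBlocks_add, sub_eq_add_neg, fromBlocks_neg,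
        fromBlocks_neg_one]
    have := congrArg (aeval (fromBlocks 0 (-1) 1 (t • 1) : Matrix (l ⊕ l) (l ⊕ l) F)) hp
    rw [map_mul, h0, zero_mul] at this
    rw [eq_neg_iff_add_eq_zero]
    simpa using this

end TwoElements


/-- Let `q` be an odd prime power, `n ≥ 1`, let `2^(s+1)` exactly divide `q² - 1`,
and `2^(r_t) ≤ 2n < 2^(r_t+1)`. Then the `2`-part of the exponent of
`PSp_{2n}(F_q) = Sp_{2n}(F_q)/Z` is `2^(s + r_t - 1)` if `n` is not a power of `2`,
and `2^(s + r_t - 2)` if `n` is a power of `2`. -/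
theorem exponent_two_part_projectiveSymplecticGroup (q : ℕ) (hq : IsPrimePow q)
    (hqodd : Odd q) (F : Type) [Field F] [Fintype F] (hF : Fintype.card F = q)
    (n s rt : ℕ) (hn : 1 ≤ n)
    (hs : 2 ^ (s + 1) ∣ q ^ 2 - 1 ∧ ¬ 2 ^ (s + 2) ∣ q ^ 2 - 1)
    (hrt1 : 2 ^ rt ≤ 2 * n) (hrt2 : 2 * n < 2 ^ (rt + 1)) :
    (¬ (∃ k : ℕ, n = 2 ^ k) →
      2 ^ (s + rt - 1) ∣
          Monoid.exponent
            ((Matrix.symplecticGroup (Fin n) F) ⧸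
              Subgroup.center (Matrix.symplecticGroup (Fin n) F)) ∧
        ¬ 2 ^ (s + rt - 1 + 1) ∣
            Monoid.exponent
              ((Matrix.symplecticGroup (Fin n) F) ⧸
                Subgroup.center (Matrix.symplecticGroup (Fin n) F))) ∧
    ((∃ k : ℕ, n = 2 ^ k) →
      2 ^ (s + rt - 2) ∣
          Monoid.exponent
            ((Matrix.symplecticGroup (Fin n) F) ⧸
              Subgroup.center (Matrix.symplecticGroup (Fin n) F)) ∧
        ¬ 2 ^ (s + rt - 2 + 1) ∣
            Monoid.exponent
              ((Matrix.symplecticGroup (Fin n) F) ⧸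
                Subgroup.center (Matrix.symplecticGroup (Fin n) F))) := by
  subst hF
  have : Nonempty (Fin n) := ⟨⟨0, hn⟩⟩
  obtain ⟨hs2, -⟩ := exists_sign_mul_sub_one_two_adic hqodd hs
  have h2 : (2 : F) ≠ 0 := FiniteField.two_ne_zero_of_odd_card hqodd
  have hneg : (-1 : F) ≠ 1 := fun h => h2 (by linear_combination -h)
  obtain ⟨k, rfl⟩ : ∃ k, rt = k + 1 := by
    refine ⟨rt - 1, ?_⟩
    rcases rt with _ | rt <;> omega
  have hk : 2 ^ k ≤ n := by rw [pow_succ] at hrt1; omega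
  have hk' : n < 2 ^ (k + 1) := by rw [pow_succ _ (k + 1)] at hrt2; omega
  have hupper : ∀ (g : Matrix.symplecticGroup (Fin n) F) (M : ℕ), g ^ 2 ^ M = 1 →
      (g : Matrix (Fin n ⊕ Fin n) (Fin n ⊕ Fin n) F) ^ 2 ^ (s + (k + 1) - 1) = 1 ∧
      (n = 2 ^ k → (g : Matrix (Fin n ⊕ Fin n) (Fin n ⊕ Fin n) F) ^ 2 ^ (s + (k + 1) - 2) = 1 ∨
        (g : Matrix (Fin n ⊕ Fin n) (Fin n ⊕ Fin n) F) ^ 2 ^ (s + (k + 1) - 2) = -1) := by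
    intro g M hM
    have := SymplecticGroup.pow_two_pow_eq hqodd hs (by simpa using hrt2) g.2
      (by simpa using congrArg Subtype.val hM)
    refine ⟨this.1, fun hnk => this.2 ?_⟩
    rw [Fintype.card_fin, hnk, pow_succ']
  have hlower := SymplecticGroup.exists_pow_eq_neg_one
    (fun l _ _ => SymplecticGroup.exists_pow_two_pow_eq_neg_one hqodd hs l) k
  simp only [← pow_add] at hlower
  refine ⟨fun hpow => ⟨?_, ?_⟩, fun hpow => ?_⟩
  · have hlt : 2 ^ k < n := lt_of_le_of_ne hk fun h => hpow ⟨k, h.symm⟩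
    have : Nonempty (Fin (n - 2 ^ k)) := ⟨⟨0, by omega⟩⟩
    obtain ⟨A, hA, hAN⟩ := hlower (Fin (2 ^ k)) (by simp)
    obtain ⟨B, hB, hB1, hB2, hB3⟩ := SymplecticGroup.exists_pow_ne_one_and_ne_neg_one hneg hA hAN
      (m := Fin (n - 2 ^ k)) (k := Fin n) (finSumFinEquiv.trans (finCongr (by omega)))
    rw [← pow_succ] at hB3
    rw [show s + (k + 1) - 1 = k + (s - 1) + 1 by omega]
    refine QuotientGroup.two_pow_dvd_exponent (g := ⟨B, hB⟩) (fun hc => ?_)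
      (SymplecticGroup.mem_center_of_coe_eq (Or.inl hB3))
    exact (SymplecticGroup.coe_eq_one_or_neg_one_of_mem_center hc).elim hB1 hB2
  · exact QuotientGroup.not_two_pow_dvd_exponent fun g M hM =>
      SymplecticGroup.mem_center_of_coe_eq (Or.inl (hupper g M hM).1)
  · have hnk : n = 2 ^ k := by
      obtain ⟨j, rfl⟩ := hpow
      rw [Nat.pow_le_pow_iff_right (by norm_num)] at hk
      rw [Nat.pow_lt_pow_iff_right (by norm_num)] at hk'
      congr 1
      omega
    refine ⟨?_, QuotientGroup.not_two_pow_dvd_exponent fun g M hM =>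
      SymplecticGroup.mem_center_of_coe_eq ((hupper g M hM).2 hnk)⟩
    obtain ⟨A, hA, hAN⟩ := hlower (Fin n) (by simpa using hnk)
    rw [show k + (s - 1) = k + (s - 2) + 1 by omega] at hAN
    rw [show s + (k + 1) - 2 = k + (s - 2) + 1 by omega]
    refine QuotientGroup.two_pow_dvd_exponent (g := ⟨A, hA⟩) (fun hc => ?_)
      (SymplecticGroup.mem_center_of_coe_eq (Or.inr hAN))
    have hsq : (A ^ 2 ^ (k + (s - 2))) ^ 2 = 1 := by
      rcases SymplecticGroup.coe_eq_one_or_neg_one_of_mem_center hc with h | h <;>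
        replace h : A ^ 2 ^ (k + (s - 2)) = _ := h
      · rw [h, one_pow]
      · rw [h, neg_one_sq]
    rw [← pow_mul, ← pow_succ, hAN] at hsq
    have i : Fin n := ⟨0, hn⟩
    have := congrFun (congrFun hsq (Sum.inl i)) (Sum.inl i)
    exact hneg (by simpa using this)
end

section
/- Let q be an odd prime power, m ≥ 1, let s be such that 2^(s+1) exactly divides q² − 1, and let r_t be the natural number with 2^(r_t) ≤ 2m < 2^(r_t+1). Then exp_2(O_{2m+1}(F_q)) = 2^(s + r_t − 1), where O_{2m+1}(F_q) = {A ∈ GL_{2m+1}(F_q) : Aᵀ·A = 1} is the orthogonal group of the standard quadratic form. -/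
universe u

section Arithmetic

variable {q s n : ℕ}

theorem padicValNat_two_pow_sub_one_of_even (hq : Odd q) (hq1 : 1 < q)
    (hs : 2 ^ (s + 1) ∣ q ^ 2 - 1 ∧ ¬ 2 ^ (s + 2) ∣ q ^ 2 - 1) (hn : n ≠ 0) (hne : Even n) :
    padicValNat 2 (q ^ n - 1) = s + padicValNat 2 n := by
  have h2 : ¬ 2 ∣ q := by rwa [← even_iff_two_dvd, Nat.not_even_iff_odd]
  have hne0 : q ^ 2 - 1 ≠ 0 := Nat.sub_ne_zero_of_lt (Nat.one_lt_pow two_ne_zero hq1)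
  have h1 := padicValNat.pow_two_sub_one hq1 h2 hn hne
  have h3 := padicValNat.pow_two_sub_one hq1 h2 two_ne_zero even_two
  rw [padicValNat.self one_lt_two] at h3
  rw [padicValNat_dvd_iff_le hne0, padicValNat_dvd_iff_le hne0] at hs
  omega

theorem not_two_pow_dvd_pow_sub_one_and_add_one_of_odd (hq : Odd q) (hq1 : 1 < q)
    (hs : 2 ^ (s + 1) ∣ q ^ 2 - 1 ∧ ¬ 2 ^ (s + 2) ∣ q ^ 2 - 1) (hn : Odd n) :
    ¬ 2 ^ (s + 1) ∣ q ^ n - 1 ∧ ¬ 2 ^ (s + 1) ∣ q ^ n + 1 := by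
  have hn0 : 2 * n ≠ 0 := by have := hn.pos; omega
  have h := padicValNat_two_pow_sub_one_of_even hq hq1 hs hn0 (even_two_mul n)
  have hne0 : q ^ (2 * n) - 1 ≠ 0 := Nat.sub_ne_zero_of_lt (Nat.one_lt_pow hn0 hq1)
  have hv : padicValNat 2 (2 * n) = 1 := by
    rw [padicValNat.mul two_ne_zero hn.pos.ne', padicValNat.self one_lt_two,
      padicValNat.eq_zero_of_not_dvd (by rwa [← even_iff_two_dvd, Nat.not_even_iff_odd])]
  have hnd : ¬ 2 ^ (s + 1 + 1) ∣ q ^ (2 * n) - 1 := by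
    rw [padicValNat_dvd_iff_le hne0]; omega
  have hf : q ^ (2 * n) - 1 = (q ^ n + 1) * (q ^ n - 1) := by
    rw [mul_comm 2 n, pow_mul, ← Nat.sq_sub_sq, one_pow]
  have ho : Odd (q ^ n) := hq.pow
  have ha : 2 ∣ q ^ n + 1 := ho.add_one.two_dvd
  have hb : 2 ∣ q ^ n - 1 := (Nat.Odd.sub_odd ho odd_one).two_dvd
  rw [hf] at hnd
  refine ⟨fun h ↦ hnd ?_, fun h ↦ hnd ?_⟩
  · rw [pow_succ, mul_comm]; exact mul_dvd_mul ha h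
  · rw [pow_succ]; exact mul_dvd_mul h hb

theorem two_le_of_two_pow_dvd (hq : Odd q)
    (hs : ¬ 2 ^ (s + 2) ∣ q ^ 2 - 1) : 2 ≤ s := by
  by_contra! h
  have := Nat.eight_dvd_sq_sub_one_of_odd hq
  exact hs ((pow_dvd_pow 2 (by omega : s + 2 ≤ 3)).trans this)

theorem two_pow_dvd_of_two_pow_dvd_pow_sub_one (hq : Odd q) (hq1 : 1 < q)
    (hs : 2 ^ (s + 1) ∣ q ^ 2 - 1 ∧ ¬ 2 ^ (s + 2) ∣ q ^ 2 - 1) {r : ℕ} (hr : 1 ≤ r)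
    (h : 2 ^ (s + r) ∣ q ^ n - 1) : 2 ^ r ∣ n := by
  rcases eq_or_ne n 0 with rfl | hn
  · exact dvd_zero _
  rcases Nat.even_or_odd n with he | ho
  · rw [padicValNat_dvd_iff_le (Nat.sub_ne_zero_of_lt (Nat.one_lt_pow hn hq1)),
      padicValNat_two_pow_sub_one_of_even hq hq1 hs hn he] at h
    rw [padicValNat_dvd_iff_le hn]
    omega
  · exact absurd ((pow_dvd_pow 2 (by omega)).trans h)
      (not_two_pow_dvd_pow_sub_one_and_add_one_of_odd hq hq1 hs ho).1

theorem not_two_pow_succ_dvd_pow_add_one (hq : Odd q) (hq1 : 1 < q)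
    (hs : 2 ^ (s + 1) ∣ q ^ 2 - 1 ∧ ¬ 2 ^ (s + 2) ∣ q ^ 2 - 1) : ¬ 2 ^ (s + 1) ∣ q ^ n + 1 := by
  rcases Nat.even_or_odd n with he | ho
  · intro h
    have h4 : 4 ∣ q ^ n + 1 :=
      (pow_dvd_pow 2 (by have := two_le_of_two_pow_dvd hq hs.2; omega : 2 ≤ s + 1)).trans h
    obtain ⟨k, rfl⟩ := he
    obtain ⟨j, hj⟩ : Odd (q ^ k) := hq.pow
    rw [pow_add, hj, (by ring : (2 * j + 1) * (2 * j + 1) + 1 = 4 * (j * j + j) + 2)] at h4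
    omega
  · exact (not_two_pow_dvd_pow_sub_one_and_add_one_of_odd hq hq1 hs ho).2

end Arithmetic

section UpperBound

open Polynomial Matrix

variable {F : Type*} [Field F] [Fintype F]

theorem orderOf_dvd_card_pow_natDegree_minpoly_sub_one {E : Type*} [Field E] [Finite E]
    [Algebra F E] {z : E} (hz : z ≠ 0) :
    orderOf z ∣ Fintype.card F ^ (minpoly F z).natDegree - 1 := by
  have hint : IsIntegral F z := .of_finite F z
  have := Fintype.ofFinite (IntermediateField.adjoin F {z})
  set g := IntermediateField.AdjoinSimple.gen F z
  have hg : algebraMap _ E g = z := IntermediateField.AdjoinSimple.algebraMap_gen F z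
  rw [← IntermediateField.adjoin.finrank hint, ← Module.card_eq_pow_finrank,
    orderOf_dvd_iff_pow_eq_one]
  have hg0 : g ≠ 0 := fun h ↦ hz (by rw [← hg, h, map_zero])
  rw [← map_one (algebraMap (IntermediateField.adjoin F {z}) E),
    ← FiniteField.pow_card_sub_one_eq_one g hg0, map_pow, hg]

theorem FiniteField.exists_eq_pow_of_isConjRoot {E : Type*} [Field E] [Finite E]
    [Algebra F E] {x y : E} (h : IsConjRoot F x y) :
    ∃ i : ℕ, x = y ^ Fintype.card F ^ i := by
  obtain ⟨σ, rfl⟩ := isConjRoot_iff_exists_algEquiv.1 h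
  obtain ⟨i, rfl⟩ := (FiniteField.bijective_frobeniusAlgEquivOfAlgebraic_pow F E).2 σ
  exact ⟨i, by simp [AlgEquiv.coe_pow, FiniteField.coe_frobeniusAlgEquivOfAlgebraic_iterate]⟩

variable {n : Type*} [Fintype n] [DecidableEq n]

theorem Matrix.aeval_charpoly_eq_zero_iff {F E : Type*} [Field F] [Field E] [Algebra F E]
    (A : Matrix n n F) (z : E) :
    aeval z A.charpoly = 0 ↔ (scalar n z - A.map (algebraMap F E)).det = 0 := by
  rw [← Matrix.eval_charpoly, Matrix.charpoly_map, eval_map_algebraMap]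

theorem Matrix.aeval_inv_charpoly_eq_zero_of_mem_orthogonalGroup {F E : Type*} [Field F]
    [Field E] [Algebra F E] {A : Matrix n n F} (hA : A ∈ orthogonalGroup n F) {z : E}
    (hz0 : z ≠ 0) (hz : aeval z A.charpoly = 0) : aeval z⁻¹ A.charpoly = 0 := by
  rw [← charpoly_transpose] at hz
  rw [aeval_charpoly_eq_zero_iff] at hz ⊢
  set B := A.map (algebraMap F E)
  have hB : B * Bᵀ = 1 := by
    rw [← transpose_map, ← Matrix.map_mul, (mem_orthogonalGroup_iff n F).1 hA]
    simp
  have h : scalar n z⁻¹ - B = (-z⁻¹) • (B * (scalar n z - Bᵀ)) := by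
    rw [mul_sub, hB]
    ext i j
    simp [Matrix.sub_apply, Matrix.smul_apply, Matrix.one_apply, Matrix.diagonal_apply]
    split_ifs <;> field_simp <;> ring
  rw [h, det_smul, det_mul, ← transpose_map, hz, mul_zero, mul_zero]

/-- An orthogonal matrix over `F_q` of size less than `2 ^ (r + 1)` has no eigenvalue that is a
primitive root of unity of order `2 ^ (s + r)`. -/
theorem Matrix.aeval_charpoly_ne_zero_of_orderOf_eq {q s r : ℕ} (hF : Fintype.card F = q)
    (hq : Odd q) (hs : 2 ^ (s + 1) ∣ q ^ 2 - 1 ∧ ¬ 2 ^ (s + 2) ∣ q ^ 2 - 1) (hr : 1 ≤ r)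
    (hn : Fintype.card n < 2 ^ (r + 1)) {A : Matrix n n F} (hA : A ∈ orthogonalGroup n F)
    {E : Type*} [Field E] [Finite E] [Algebra F E] {z : E} (hz : orderOf z = 2 ^ (s + r)) :
    aeval z A.charpoly ≠ 0 := by
  intro hroot
  have hq1 : 1 < q := hF ▸ Fintype.one_lt_card
  have hz0 : z ≠ 0 := by
    rintro rfl
    rw [orderOf_zero] at hz
    exact (pow_pos two_pos _).ne hz
  have hzinv : orderOf z⁻¹ = 2 ^ (s + r) := by
    have h := orderOf_inv (Units.mk0 z hz0)
    rwa [← orderOf_units, ← orderOf_units, Units.val_inv_eq_inv_val, Units.val_mk0, hz] at h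
  have hroot' := aeval_inv_charpoly_eq_zero_of_mem_orthogonalGroup hA hz0 hroot
  have hdeg (w : E) (hw0 : w ≠ 0) (hw : orderOf w = 2 ^ (s + r)) :
      2 ^ r ≤ (minpoly F w).natDegree := by
    refine Nat.le_of_dvd (minpoly.natDegree_pos (.of_finite F w)) ?_
    refine two_pow_dvd_of_two_pow_dvd_pow_sub_one hq hq1 hs hr ?_
    rw [← hw, ← hF]
    exact orderOf_dvd_card_pow_natDegree_minpoly_sub_one hw0
  by_cases hconj : IsConjRoot F z⁻¹ z
  · obtain ⟨i, hi⟩ := FiniteField.exists_eq_pow_of_isConjRoot hconj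
    have h1 : z ^ (q ^ i + 1) = 1 := by
      rw [pow_succ, ← hF, ← hi, inv_mul_cancel₀ hz0]
    have h2 := orderOf_dvd_of_pow_eq_one h1
    rw [hz] at h2
    exact not_two_pow_succ_dvd_pow_add_one hq hq1 hs ((pow_dvd_pow 2 (by omega)).trans h2)
  · have hcop : IsCoprime (minpoly F z⁻¹) (minpoly F z) := by
      refine ((minpoly.irreducible (.of_finite F _)).coprime_iff_not_dvd).2 fun h ↦ hconj ?_
      exact eq_of_monic_of_associated (minpoly.monic (.of_finite F _))
        (minpoly.monic (.of_finite F _)) ((minpoly.irreducible (.of_finite F _)).associated_of_dvd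
          (minpoly.irreducible (.of_finite F _)) h)
    have hdvd := hcop.mul_dvd (minpoly.dvd F _ hroot') (minpoly.dvd F _ hroot)
    have hle := natDegree_le_of_dvd hdvd A.charpoly_monic.ne_zero
    rw [natDegree_mul (minpoly.ne_zero (.of_finite F _)) (minpoly.ne_zero (.of_finite F _)),
      charpoly_natDegree_eq_dim] at hle
    have h1 := hdeg z hz0 hz
    have h2 := hdeg z⁻¹ (inv_ne_zero hz0) hzinv
    rw [pow_succ] at hn
    omega

theorem Matrix.exists_finite_extension_aeval_charpoly_eq_zero {F : Type u} [Field F] [Finite F]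
    {A : Matrix n n F} {N : ℕ}
    (h1 : A ^ N ≠ 1) (h2 : A ^ (2 * N) = 1) :
    ∃ (E : Type u) (_ : Field E) (_ : Finite E) (_ : Algebra F E) (z : E),
      z ^ N = -1 ∧ aeval z A.charpoly = 0 := by
  have hncop : ¬ IsCoprime (minpoly F A) (X ^ N + 1) := by
    intro h
    refine h1 (sub_eq_zero.1 ?_)
    have hd : minpoly F A ∣ X ^ N - 1 := by
      refine h.dvd_of_dvd_mul_right (minpoly.dvd F A ?_)
      have : (X ^ N - 1) * (X ^ N + 1) = (X ^ (2 * N) - 1 : F[X]) := by ring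
      simp [this, h2]
    simpa using aeval_eq_zero_of_dvd_aeval_eq_zero hd (minpoly.aeval F A)
  rw [Polynomial.isCoprime_iff_aeval_ne_zero_of_isAlgClosed F (AlgebraicClosure F)] at hncop
  push Not at hncop
  obtain ⟨w, hw, hwN⟩ := hncop
  have hint : IsIntegral F w := Algebra.IsIntegral.isIntegral w
  have : FiniteDimensional F (IntermediateField.adjoin F {w}) :=
    IntermediateField.adjoin.finiteDimensional hint
  refine ⟨IntermediateField.adjoin F {w}, inferInstance, Module.finite_of_finite F, inferInstance,
    IntermediateField.AdjoinSimple.gen F w, ?_, ?_⟩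
  · apply (algebraMap _ (AlgebraicClosure F)).injective
    simpa [add_eq_zero_iff_eq_neg] using hwN
  · apply (algebraMap _ (AlgebraicClosure F)).injective
    rw [← aeval_algebraMap_apply, IntermediateField.AdjoinSimple.algebraMap_gen, map_zero]
    exact aeval_eq_zero_of_dvd_aeval_eq_zero (minpoly_dvd_charpoly A) hw

theorem Matrix.not_two_pow_dvd_exponent_orthogonalGroup {q s r : ℕ} (hF : Fintype.card F = q)
    (hq : Odd q) (hs : 2 ^ (s + 1) ∣ q ^ 2 - 1 ∧ ¬ 2 ^ (s + 2) ∣ q ^ 2 - 1) (hr : 1 ≤ r)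
    (hn : Fintype.card n < 2 ^ (r + 1)) :
    ¬ 2 ^ (s + r) ∣ Monoid.exponent (orthogonalGroup n F) := by
  intro h
  obtain ⟨g, hg⟩ := Nat.prime_two.exists_orderOf_eq_pow_factorization_exponent
    (orthogonalGroup n F)
  obtain ⟨k, hk⟩ : 2 ^ (s + r) ∣ orderOf g := by
    rw [hg]
    exact pow_dvd_pow _ ((Nat.prime_two.pow_dvd_iff_le_factorization
      Monoid.exponent_ne_zero_of_finite).1 h)
  have hk0 : k ≠ 0 := by rintro rfl; exact (orderOf_pos g).ne' (by simpa using hk)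
  have hgk : orderOf (g ^ k) = 2 ^ (s + r) := by
    rw [orderOf_pow_of_dvd hk0 ⟨_, (hk.trans (mul_comm _ _))⟩, hk]
    exact Nat.mul_div_cancel _ (Nat.pos_of_ne_zero hk0)
  obtain ⟨t, rfl⟩ : ∃ t, r = t + 1 := ⟨r - 1, by omega⟩
  set A : orthogonalGroup n F := g ^ k
  have h1 : A.1 ^ 2 ^ (s + t) ≠ 1 := fun h ↦ by
    have := Nat.le_of_dvd (by positivity)
      (orderOf_dvd_of_pow_eq_one (x := A) (n := 2 ^ (s + t)) (Subtype.ext (by simpa using h)))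
    rw [hgk] at this
    exact absurd this (not_le.2 (Nat.pow_lt_pow_right one_lt_two (by omega)))
  have h2 : A.1 ^ (2 * 2 ^ (s + t)) = 1 := by
    rw [← pow_succ', add_assoc, ← hgk]
    exact congrArg Subtype.val (pow_orderOf_eq_one A)
  obtain ⟨E, _, _, _, z, hz, hroot⟩ := exists_finite_extension_aeval_charpoly_eq_zero h1 h2
  have hchar : ringChar F ≠ 2 := fun h ↦ by
    have := FiniteField.even_card_iff_char_two.1 h
    rw [hF] at this
    exact Nat.not_even_iff_odd.2 hq (Nat.even_iff.2 this)
  have hne : (-1 : E) ≠ 1 := by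
    have h := (algebraMap F E).injective.ne (Ring.neg_one_ne_one_of_char_ne_two hchar)
    simpa using h
  refine aeval_charpoly_ne_zero_of_orderOf_eq hF hq hs hr hn A.2 (z := z) ?_ hroot
  rw [← add_assoc]
  refine orderOf_eq_prime_pow (by rwa [hz]) ?_
  rw [pow_succ, pow_mul, hz, neg_one_sq]

end UpperBound

section LowerBound

open Matrix

variable {F : Type*} [Field F]
variable {ι κ : Type*} [Fintype ι] [Fintype κ] [DecidableEq ι] [DecidableEq κ]

theorem Matrix.exponent_orthogonalGroup_dvd_of_card_le (h : Fintype.card κ ≤ Fintype.card ι) :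
    Monoid.exponent (orthogonalGroup κ F) ∣ Monoid.exponent (orthogonalGroup ι F) := by
  obtain ⟨e⟩ : Nonempty (κ ⊕ Fin (Fintype.card ι - Fintype.card κ) ≃ ι) :=
    Fintype.card_eq.1 (by simp [h])
  let f : Matrix κ κ F → Matrix ι ι F := fun A ↦ reindexAlgEquiv F F e (fromBlocks A 0 0 1)
  have hmem (A : orthogonalGroup κ F) : f A ∈ orthogonalGroup ι F := by
    have hA := (mem_orthogonalGroup_iff κ F).1 A.2
    rw [mem_orthogonalGroup_iff]
    simp only [f, coe_reindexAlgEquiv, transpose_reindex, fromBlocks_transpose]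
    rw [← coe_reindexAlgEquiv F F, ← map_mul, fromBlocks_multiply]
    simp [hA]
  refine Monoid.exponent_dvd_of_forall_pow_eq_one fun A ↦ Subtype.ext ?_
  have h1 := congrArg Subtype.val (Monoid.pow_exponent_eq_one (⟨f A, hmem A⟩ : orthogonalGroup ι F))
  simp only [SubmonoidClass.coe_pow, OneMemClass.coe_one, f] at h1 ⊢
  rw [← map_pow, fromBlocks_diagonal_pow, map_eq_one_iff _ (reindexAlgEquiv F F e).injective,
    one_pow, ← fromBlocks_one] at h1
  exact (fromBlocks_inj.1 h1).1

/-- If `-1 = J * Jᵀ`, the sum of `2h` squares is a hyperbolic form, so `GL_h` acts on it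
faithfully. -/
theorem Matrix.pow_exponent_orthogonalGroup_sum_eq_one (h2 : (2 : F) ≠ 0) {J : Matrix κ κ F}
    (hJ : J * Jᵀ = -1) {g g' : Matrix κ κ F} (hg : g * g' = 1) :
    g ^ Monoid.exponent (orthogonalGroup (κ ⊕ κ) F) = 1 := by
  have hg' : g' * g = 1 := mul_eq_one_comm.1 hg
  let P : Matrix (κ ⊕ κ) (κ ⊕ κ) F := fromBlocks 1 1 Jᵀ (-Jᵀ)
  let Q : Matrix (κ ⊕ κ) (κ ⊕ κ) F := (2 : F)⁻¹ • fromBlocks 1 (-J) 1 J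
  have htwo : (2 : F)⁻¹ • (1 + 1 : Matrix κ κ F) = 1 := by
    rw [← two_smul F (1 : Matrix κ κ F), inv_smul_smul₀ h2]
  have hQP : Q * P = 1 := by
    simp only [Q, P, smul_mul, fromBlocks_multiply, fromBlocks_smul]
    simp [hJ, ← smul_add, htwo]
  have hPQ : P * Q = 1 := mul_eq_one_comm.1 hQP
  have hPP : Pᵀ * P = fromBlocks 0 ((2 : F) • 1) ((2 : F) • 1) 0 := by
    simp only [P, fromBlocks_transpose, fromBlocks_multiply]
    simp [hJ, two_smul]
  have hQQ : Qᵀ * fromBlocks 0 ((2 : F) • 1) ((2 : F) • 1) 0 * Q = 1 := by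
    rw [← hPP, mul_assoc, mul_assoc, hPQ, mul_one, ← transpose_mul, hPQ, transpose_one]
  let D : Matrix (κ ⊕ κ) (κ ⊕ κ) F := fromBlocks g 0 0 g'ᵀ
  have hD : Dᵀ * fromBlocks 0 ((2 : F) • 1) ((2 : F) • 1) 0 * D =
      fromBlocks 0 ((2 : F) • 1) ((2 : F) • 1) 0 := by
    simp only [D, fromBlocks_transpose, fromBlocks_multiply]
    simp [hg', ← transpose_mul]
  have hmem : P * D * Q ∈ orthogonalGroup (κ ⊕ κ) F := by
    rw [mem_orthogonalGroup_iff', transpose_mul, transpose_mul]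
    calc Qᵀ * (Dᵀ * Pᵀ) * (P * D * Q) = Qᵀ * (Dᵀ * (Pᵀ * P) * D) * Q := by noncomm_ring
      _ = 1 := by rw [hPP, hD, hQQ]
  have hpow (k : ℕ) : (P * D * Q) ^ k = P * D ^ k * Q := by
    induction k with
    | zero => simp [hPQ]
    | succ k ih =>
      rw [pow_succ, ih, pow_succ]
      calc P * D ^ k * Q * (P * D * Q) = P * D ^ k * (Q * P) * D * Q := by noncomm_ring
        _ = P * (D ^ k * D) * Q := by rw [hQP]; noncomm_ring
  have h1 := congrArg Subtype.val
    (Monoid.pow_exponent_eq_one (⟨_, hmem⟩ : orthogonalGroup (κ ⊕ κ) F))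
  simp only [SubmonoidClass.coe_pow, OneMemClass.coe_one, hpow] at h1
  generalize Monoid.exponent (orthogonalGroup (κ ⊕ κ) F) = k at h1 ⊢
  have h3 : D ^ k = 1 := by
    calc D ^ k = Q * P * D ^ k * (Q * P) := by rw [hQP, one_mul, mul_one]
      _ = Q * (P * D ^ k * Q) * P := by noncomm_ring
      _ = 1 := by rw [h1, mul_one, hQP]
  rw [fromBlocks_diagonal_pow, ← fromBlocks_one] at h3
  exact (fromBlocks_inj.1 h3).1

theorem orderOf_dvd_exponent_orthogonalGroup_sum (h2 : (2 : F) ≠ 0) {J : Matrix κ κ F}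
    (hJ : J * Jᵀ = -1) {E : Type*} [Field E] [Algebra F E] (b : Module.Basis κ F E) {z : E}
    (hz : z ≠ 0) : orderOf z ∣ Monoid.exponent (orthogonalGroup (κ ⊕ κ) F) := by
  refine orderOf_dvd_of_pow_eq_one (Algebra.leftMulMatrix_injective b ?_)
  rw [map_pow, map_one]
  refine pow_exponent_orthogonalGroup_sum_eq_one h2 hJ (g' := Algebra.leftMulMatrix b z⁻¹) ?_
  rw [← map_mul, mul_inv_cancel₀ hz, map_one]

theorem Matrix.exists_mul_transpose_eq_neg_one {x y : F} (h : x ^ 2 + y ^ 2 = -1) :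
    ∃ J : Matrix (κ ⊕ κ) (κ ⊕ κ) F, J * Jᵀ = -1 := by
  refine ⟨fromBlocks (x • 1) (y • 1) (-y • 1) (x • 1), ?_⟩
  rw [fromBlocks_transpose, fromBlocks_multiply, ← fromBlocks_one, fromBlocks_neg]
  have h' : (x * x) • (1 : Matrix κ κ F) + (y * y) • 1 = -1 := by
    rw [← add_smul, ← sq, ← sq, h, neg_one_smul]
  simp [smul_smul, mul_comm y x, h', add_comm ((y * y) • (1 : Matrix κ κ F))]

theorem FiniteField.exists_sq_add_sq_eq_neg_one (F : Type*) [Field F] [Finite F] :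
    ∃ x y : F, x ^ 2 + y ^ 2 = -1 := by
  have : NeZero (ringChar F) := ⟨CharP.ringChar_ne_zero_of_finite F⟩
  obtain ⟨a, b, h⟩ := CharP.sq_add_sq F (ringChar F) (-1)
  exact ⟨a, b, by simpa using h⟩

theorem FiniteField.exists_orderOf_eq_of_dvd {E : Type*} [Field E] [Finite E] {k : ℕ}
    (hk : k ∣ Nat.card E - 1) : ∃ z : E, z ≠ 0 ∧ orderOf z = k := by
  rw [← Nat.card_units] at hk
  obtain ⟨u, hu⟩ := IsCyclic.exists_ofOrder_eq_natCard (α := Eˣ)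
  obtain ⟨c, hc⟩ := hk
  have hpos : Nat.card Eˣ ≠ 0 := Nat.card_pos.ne'
  have hc0 : c ≠ 0 := by rintro rfl; exact hpos (by simpa using hc)
  refine ⟨(u ^ c : Eˣ), Units.ne_zero _, ?_⟩
  rw [orderOf_units, orderOf_pow_of_dvd hc0 (by rw [hu, hc]; exact dvd_mul_left _ _), hu, hc]
  exact Nat.mul_div_cancel _ (Nat.pos_of_ne_zero hc0)

/-- A rotation matrix has eigenvalue `x + y * i`. -/
theorem orderOf_add_mul_dvd_exponent_orthogonalGroup_two {E : Type*} [Field E] [Algebra F E]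
    {x y : F} (hxy : x ^ 2 + y ^ 2 = 1) {i : E} (hi : i ^ 2 = -1) :
    orderOf (algebraMap F E x + algebraMap F E y * i) ∣
      Monoid.exponent (orthogonalGroup (Fin 2) F) := by
  have hmem : !![x, -y; y, x] ∈ orthogonalGroup (Fin 2) F := by
    rw [mem_orthogonalGroup_iff]
    ext a b
    fin_cases a <;> fin_cases b <;> simp [Matrix.mul_apply] <;>
      first | linear_combination hxy | ring
  set z := algebraMap F E x + algebraMap F E y * i
  set R := (!![x, -y; y, x]).map (algebraMap F E)
  have hpow (k : ℕ) : R ^ k *ᵥ ![1, -i] = z ^ k • ![1, -i] := by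
    induction k with
    | zero => simp
    | succ k ih =>
      have hR : R *ᵥ ![1, -i] = z • ![1, -i] := by
        ext a
        fin_cases a
        · simp [R, z, Matrix.mulVec, dotProduct]
        · simp [R, z, Matrix.mulVec, dotProduct]
          linear_combination algebraMap F E y * hi
      rw [pow_succ, ← mulVec_mulVec, hR, mulVec_smul, ih, smul_smul, pow_succ']
  have h1 := congrArg Subtype.val
    (Monoid.pow_exponent_eq_one (⟨_, hmem⟩ : orthogonalGroup (Fin 2) F))
  simp only [SubmonoidClass.coe_pow, OneMemClass.coe_one] at h1
  refine orderOf_dvd_of_pow_eq_one ?_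
  have h2 := congrFun (hpow (Monoid.exponent (orthogonalGroup (Fin 2) F))) 0
  rw [← Matrix.map_pow, h1] at h2
  simpa using h2.symm

theorem FiniteField.exists_algebraMap_eq_of_pow_card_eq {F E : Type*} [Field F] [Fintype F]
    [Field E] [Finite E] [Algebra F E] {x : E} (h : x ^ Fintype.card F = x) :
    ∃ y : F, algebraMap F E y = x := by
  refine (IsGalois.mem_range_algebraMap_iff_fixed x).2 fun g ↦ ?_
  obtain ⟨i, rfl⟩ := (FiniteField.bijective_frobeniusAlgEquivOfAlgebraic_pow F E).2 g
  have h' (k : ℕ) : x ^ Fintype.card F ^ k = x := by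
    induction k with
    | zero => simp
    | succ k ih => rw [pow_succ, pow_mul, ih, h]
  simp [AlgEquiv.coe_pow, FiniteField.coe_frobeniusAlgEquivOfAlgebraic_iterate, h']

theorem FiniteField.exists_field_extension_finrank_eq (F : Type u) [Field F] [Finite F] {n : ℕ}
    (hn : n ≠ 0) : ∃ (E : Type) (_ : Field E) (_ : Finite E) (_ : Algebra F E),
      Module.finrank F E = n := by
  have : NeZero n := ⟨hn⟩
  have : Fact (ringChar F).Prime := ⟨CharP.prime_ringChar F⟩
  exact ⟨FiniteField.Extension F (ringChar F) n, inferInstance, inferInstance, inferInstance,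
    FiniteField.finrank_extension F (ringChar F) n⟩

theorem dvd_exponent_orthogonalGroup_sum {F : Type*} [Field F] [Fintype F] (h2 : (2 : F) ≠ 0)
    [Nonempty κ] {J : Matrix κ κ F} (hJ : J * Jᵀ = -1) {k : ℕ}
    (hk : k ∣ Fintype.card F ^ Fintype.card κ - 1) :
    k ∣ Monoid.exponent (orthogonalGroup (κ ⊕ κ) F) := by
  obtain ⟨E, _, _, _, hE⟩ :=
    FiniteField.exists_field_extension_finrank_eq F (Fintype.card_ne_zero (α := κ))
  have : FiniteDimensional F E := Module.Finite.of_finite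
  have hcard : Nat.card E = Fintype.card F ^ Fintype.card κ := by
    rw [Module.natCard_eq_pow_finrank (K := F), Nat.card_eq_fintype_card, hE]
  obtain ⟨z, hz0, rfl⟩ := FiniteField.exists_orderOf_eq_of_dvd (hcard ▸ hk)
  exact orderOf_dvd_exponent_orthogonalGroup_sum h2 hJ
    ((Module.finBasisOfFinrankEq F E hE).reindex (Fintype.equivFin κ).symm) hz0

theorem dvd_exponent_orthogonalGroup_two_of_dvd_card_add_one {F : Type*} [Field F] [Fintype F]
    (h4 : Fintype.card F % 4 = 3) {k : ℕ} (hk : k ∣ Fintype.card F + 1) :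
    k ∣ Monoid.exponent (orthogonalGroup (Fin 2) F) := by
  set q := Fintype.card F with hq
  obtain ⟨E, _, _, _, hE⟩ := FiniteField.exists_field_extension_finrank_eq F two_ne_zero
  have hcard : Nat.card E - 1 = (q + 1) * (q - 1) := by
    rw [Module.natCard_eq_pow_finrank (K := F), Nat.card_eq_fintype_card, hE, ← hq,
      ← Nat.sq_sub_sq, one_pow]
  obtain ⟨z, hz0, hz⟩ := FiniteField.exists_orderOf_eq_of_dvd (hcard ▸ hk.mul_right (q - 1))
  obtain ⟨i, hi0, hi⟩ := FiniteField.exists_orderOf_eq_of_dvd (E := E) (k := 4)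
    (hcard ▸ Dvd.dvd.mul_right (by omega) (q - 1))
  have hi2 : i ^ 2 = -1 := by
    have h1 : i ^ 4 = 1 := hi ▸ pow_orderOf_eq_one i
    have h2 : i ^ 2 ≠ 1 := fun h ↦ by
      have := Nat.le_of_dvd two_pos (orderOf_dvd_of_pow_eq_one h)
      omega
    have h3 : (i ^ 2 - 1) * (i ^ 2 + 1) = 0 := by linear_combination h1
    exact eq_neg_of_add_eq_zero_left ((mul_eq_zero.1 h3).resolve_left (sub_ne_zero.2 h2))
  have hiq : i ^ q = -i := by
    rw [← Nat.div_add_mod q 4, h4, pow_add, pow_mul, ← hi, pow_orderOf_eq_one, one_pow]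
    linear_combination i * hi2
  have hzq : z ^ q = z⁻¹ := by
    refine eq_inv_of_mul_eq_one_left ?_
    rw [← pow_succ]
    exact orderOf_dvd_iff_pow_eq_one.1 (hz ▸ hk)
  have h2F : (2 : F) ≠ 0 := Ring.two_ne_zero fun h ↦ by
    have := FiniteField.even_card_iff_char_two.1 h
    omega
  have h2 : (2 : E) ≠ 0 := by
    rw [← map_ofNat (algebraMap F E) 2]
    exact (map_ne_zero _).2 h2F
  let φ := FiniteField.frobeniusAlgHom F E
  have hφ (w : E) : φ w = w ^ q := rfl
  obtain ⟨x, hx⟩ := FiniteField.exists_algebraMap_eq_of_pow_card_eq (F := F) (E := E)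
    (x := (z + z⁻¹) / 2) <| by
      rw [← hq, ← hφ, map_div₀, map_add, map_inv₀, map_ofNat, hφ, hzq, inv_inv, add_comm]
  obtain ⟨y, hy⟩ := FiniteField.exists_algebraMap_eq_of_pow_card_eq (F := F) (E := E)
    (x := (z - z⁻¹) / (2 * i)) <| by
      rw [← hq, ← hφ, map_div₀, map_sub, map_inv₀, map_mul, map_ofNat, hφ, hφ, hzq, hiq, inv_inv]
      field_simp
      ring
  have hxy : x ^ 2 + y ^ 2 = 1 := by
    apply (algebraMap F E).injective
    simp only [map_add, map_pow, hx, hy, map_one, div_pow, mul_pow, hi2]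
    field_simp
    ring
  have hz' : algebraMap F E x + algebraMap F E y * i = z := by
    rw [hx, hy]
    field_simp
    ring
  rw [← hz, ← hz']
  exact orderOf_add_mul_dvd_exponent_orthogonalGroup_two hxy hi2

theorem two_pow_dvd_exponent_orthogonalGroup {F : Type*} [Field F] [Fintype F] {q s r : ℕ}
    (hF : Fintype.card F = q) (hq : Odd q)
    (hs : 2 ^ (s + 1) ∣ q ^ 2 - 1 ∧ ¬ 2 ^ (s + 2) ∣ q ^ 2 - 1) (hr : 1 ≤ r)
    (hι : 2 ^ r ≤ Fintype.card ι) :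
    2 ^ (s + r - 1) ∣ Monoid.exponent (orthogonalGroup ι F) := by
  have hq1 : 1 < q := hF ▸ Fintype.one_lt_card
  have h2 : (2 : F) ≠ 0 := Ring.two_ne_zero fun h ↦ by
    have := FiniteField.even_card_iff_char_two.1 h
    rw [hF] at this
    exact Nat.not_even_iff_odd.2 hq (Nat.even_iff.2 this)
  obtain rfl | ⟨t, rfl⟩ : r = 1 ∨ ∃ t, r = t + 2 := by
    rcases r with _ | _ | t
    · omega
    · exact .inl rfl
    · exact .inr ⟨t, rfl⟩
  · rw [Nat.add_sub_cancel]
    have hfac : q ^ 2 - 1 = (q + 1) * (q - 1) := by rw [← Nat.sq_sub_sq, one_pow]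
    rw [hfac] at hs
    obtain ⟨l, rfl⟩ := hq
    by_cases hsq : IsSquare (-1 : F)
    · have hmod := FiniteField.isSquare_neg_one_iff.1 hsq
      rw [hF] at hmod
      refine Dvd.dvd.trans ?_ (exponent_orthogonalGroup_dvd_of_card_le
        (κ := Fin 1 ⊕ Fin 1) (by simpa using hι))
      obtain ⟨i, hi⟩ := hsq
      refine dvd_exponent_orthogonalGroup_sum h2 (J := i • 1) (by simp [smul_smul, ← hi]) ?_
      rw [hF, Fintype.card_fin, pow_one]
      have hodd : Nat.Coprime (2 ^ s) (l + 1) :=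
        Nat.Coprime.pow_left _ ((Nat.coprime_two_left).2 (Nat.odd_iff.2 (by omega)))
      refine hodd.dvd_of_dvd_mul_left (Nat.dvd_of_mul_dvd_mul_left two_pos ?_)
      rw [← pow_succ', ← mul_assoc, mul_add_one]
      exact hs.1
    · have hmod : (2 * l + 1) % 4 = 3 := by
        rw [FiniteField.isSquare_neg_one_iff, hF] at hsq
        omega
      refine Dvd.dvd.trans ?_ (exponent_orthogonalGroup_dvd_of_card_le
        (κ := Fin 2) (by simpa using hι))
      refine dvd_exponent_orthogonalGroup_two_of_dvd_card_add_one (by rw [hF, hmod]) ?_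
      rw [hF]
      have hodd : Nat.Coprime (2 ^ s) l :=
        Nat.Coprime.pow_left _ ((Nat.coprime_two_left).2 (Nat.odd_iff.2 (by omega)))
      refine hodd.dvd_of_dvd_mul_right (Nat.dvd_of_mul_dvd_mul_left two_pos ?_)
      rw [← pow_succ', mul_left_comm]
      exact hs.1
  · let κ := Fin (2 ^ t) ⊕ Fin (2 ^ t)
    have hκ : Fintype.card κ = 2 ^ (t + 1) := by simp [κ, pow_succ, mul_two]
    have : NeZero (2 ^ t) := ⟨by positivity⟩
    obtain ⟨x, y, hxy⟩ := FiniteField.exists_sq_add_sq_eq_neg_one F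
    obtain ⟨J, hJ⟩ := exists_mul_transpose_eq_neg_one (κ := Fin (2 ^ t)) hxy
    refine Dvd.dvd.trans ?_ (exponent_orthogonalGroup_dvd_of_card_le (κ := κ ⊕ κ)
      (by rwa [Fintype.card_sum, hκ, ← mul_two, ← pow_succ]))
    refine dvd_exponent_orthogonalGroup_sum h2 hJ ?_
    have hne : 2 ^ (t + 1) ≠ 0 := by positivity
    rw [hF, hκ, padicValNat_dvd_iff_le (Nat.sub_ne_zero_of_lt (Nat.one_lt_pow hne hq1)),
      padicValNat_two_pow_sub_one_of_even hq hq1 hs hne (by simp [Nat.even_pow]),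
      padicValNat.prime_pow]
    omega

end LowerBound

/-- Let `q` be an odd prime power, `m ≥ 1`, let `2^(s+1)` exactly divide `q² - 1`,
and `2^(r_t) ≤ 2m < 2^(r_t+1)`. Then the `2`-part of the exponent of the orthogonal
group `O_{2m+1}(F_q)` is `2^(s + r_t - 1)`. -/
theorem exponent_two_part_orthogonalGroup_odd_dim (q : ℕ) (hq : IsPrimePow q)
    (hqodd : Odd q) (F : Type) [Field F] [Fintype F] (hF : Fintype.card F = q)
    (m s rt : ℕ) (hm : 1 ≤ m)
    (hs : 2 ^ (s + 1) ∣ q ^ 2 - 1 ∧ ¬ 2 ^ (s + 2) ∣ q ^ 2 - 1)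
    (hrt1 : 2 ^ rt ≤ 2 * m) (hrt2 : 2 * m < 2 ^ (rt + 1)) :
    2 ^ (s + rt - 1) ∣ Monoid.exponent (Matrix.orthogonalGroup (Fin (2 * m + 1)) F) ∧
      ¬ 2 ^ (s + rt - 1 + 1) ∣
          Monoid.exponent (Matrix.orthogonalGroup (Fin (2 * m + 1)) F) := by
  have hr : 1 ≤ rt := by
    by_contra! h
    obtain rfl : rt = 0 := by omega
    omega
  refine ⟨two_pow_dvd_exponent_orthogonalGroup hF hqodd hs hr (by rw [Fintype.card_fin]; omega), ?_⟩
  rw [Nat.sub_add_cancel (by omega)]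
  refine Matrix.not_two_pow_dvd_exponent_orthogonalGroup hF hqodd hs hr ?_
  rw [Fintype.card_fin]
  rw [pow_succ] at hrt2 ⊢
  omega
end

section
/- Let p be an odd prime and q an odd prime power with p not dividing q. Let e = ord_p(q), let r be such that p^r exactly divides q^e − 1, and let m ≥ 1. If e is even and v satisfies e·p^v ≤ 2m+1 < e·p^(v+1), then exp_p(O_{2m+1}(F_q)) = p^(r+v); if e is odd and v satisfies 2e·p^v ≤ 2m < 2e·p^(v+1), then exp_p(O_{2m+1}(F_q)) = p^(r+v). -/
section

open Matrix

theorem Nat.dvd_pow_sub_one_iff_orderOf_dvd {p q : ℕ} (hq : 0 < q) (t : ℕ) :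
    p ∣ q ^ t - 1 ↔ orderOf (q : ZMod p) ∣ t := by
  rw [orderOf_dvd_iff_pow_eq_one, ← CharP.cast_eq_zero_iff (ZMod p) p,
    Nat.cast_sub (Nat.one_le_pow _ _ hq), sub_eq_zero]
  simp

/-- Lifting the exponent: the order of `q` modulo `p ^ (r + j)` is `p ^ j` times its order modulo
`p`, where `p ^ r` exactly divides `q ^ orderOf (q : ZMod p) - 1`. -/
theorem Nat.pow_add_dvd_pow_sub_one_iff {p q r : ℕ} (hp : p.Prime) (hodd : Odd p) (hpq : ¬ p ∣ q)
    (hr : p ^ r ∣ q ^ orderOf (q : ZMod p) - 1)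
    (hr' : ¬ p ^ (r + 1) ∣ q ^ orderOf (q : ZMod p) - 1) (j t : ℕ) :
    p ^ (r + j) ∣ q ^ t - 1 ↔ orderOf (q : ZMod p) * p ^ j ∣ t := by
  have hq : 0 < q := Nat.pos_of_ne_zero fun h => hpq (h ▸ dvd_zero p)
  have hdvd := dvd_pow_sub_one_iff_orderOf_dvd (p := p) hq
  generalize orderOf (q : ZMod p) = e at *
  have hr0 : r ≠ 0 := by
    rintro rfl
    exact hr' (by simpa using (hdvd e).2 dvd_rfl)
  have key (s : ℕ) : p ^ (r + j) ∣ q ^ (e * s) - 1 ↔ p ^ j ∣ s := by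
    have h := Nat.emultiplicity_pow_sub_pow hp hodd (x := q ^ e) (y := 1) ((hdvd e).2 dvd_rfl)
      (fun h => hpq (hp.dvd_of_dvd_pow h)) s
    rw [(emultiplicity_eq_coe (n := r)).2 ⟨hr, hr'⟩, one_pow, ← pow_mul] at h
    rw [pow_dvd_iff_le_emultiplicity, pow_dvd_iff_le_emultiplicity, h, Nat.cast_add,
      ENat.add_le_add_iff_left (ENat.natCast_ne_top r)]
  constructor
  · intro h
    obtain ⟨s, rfl⟩ := (hdvd t).1 ((dvd_pow_self p (by omega)).trans h)
    exact mul_dvd_mul_left e ((key s).1 h)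
  · rintro ⟨s, rfl⟩
    rw [mul_assoc]
    exact (key _).2 (dvd_mul_right _ _)

theorem FiniteField.exists_mul_sq_add_sq_eq {F : Type*} [Field F] [Fintype F]
    (hF : Fintype.card F % 2 = 1) {c : F} (hc : c ≠ 0) (a : F) :
    ∃ x y : F, c * x ^ 2 + y ^ 2 = a := by
  obtain ⟨x, y, h⟩ := FiniteField.exists_root_sum_quadratic
    (f := Polynomial.C c * Polynomial.X ^ 2 + Polynomial.C 0 * Polynomial.X + Polynomial.C 0)
    (g := Polynomial.C 1 * Polynomial.X ^ 2 + Polynomial.C 0 * Polynomial.X + Polynomial.C (-a))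
    (Polynomial.degree_quadratic hc) (Polynomial.degree_quadratic one_ne_zero) hF
  refine ⟨x, y, ?_⟩
  simp at h
  linear_combination h

/-- Over a finite field of odd order, a diagonal form in fewer than `n` variables embeds
isometrically into the standard form in `n` variables. -/
theorem FiniteField.exists_orthogonal_family {F : Type*} [Field F] [Fintype F]
    (hF : Fintype.card F % 2 = 1) {n : ℕ} (a : ℕ → F) (ha : ∀ i, a i ≠ 0) {k : ℕ} (hk : k < n) :
    ∃ w : ℕ → Fin n → F, ∀ i < k, ∀ j < k, w i ⬝ᵥ w j = if i = j then a i else 0 := by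
  suffices ∀ k < n, ∃ (w : ℕ → Fin n → F) (u : Fin n → F),
      (∀ i < k, ∀ j < k, w i ⬝ᵥ w j = if i = j then a i else 0) ∧
      (∀ i < k, w i ⬝ᵥ u = 0) ∧ u ⬝ᵥ u ≠ 0 ∧
      (∀ i < k, ∀ l : Fin n, k < l → w i l = 0) ∧ ∀ l : Fin n, k < l → u l = 0 by
    obtain ⟨w, u, h, -⟩ := this k hk
    exact ⟨w, h⟩
  clear hk k
  intro k hk
  induction k with
  | zero =>
    refine ⟨0, Pi.single ⟨0, hk⟩ 1, by simp, by simp, by simp, by simp, fun l hl => ?_⟩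
    exact Pi.single_eq_of_ne (fun h => by simp [h] at hl) _
  | succ k ih =>
    obtain ⟨w, u, hw, hwu, hu, hws, hus⟩ := ih (by omega)
    obtain ⟨x, y, hxy⟩ := exists_mul_sq_add_sq_eq hF hu (a k)
    set ε : Fin n → F := Pi.single ⟨k + 1, hk⟩ 1 with hε
    have hwε : ∀ i < k, w i ⬝ᵥ ε = 0 := fun i hi => by
      simp [hε, hws i hi ⟨k + 1, hk⟩ (by simp)]
    have huε : u ⬝ᵥ ε = 0 := by simp [hε, hus ⟨k + 1, hk⟩ (by simp)]
    have hεε : ε ⬝ᵥ ε = 1 := by simp [hε]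
    have hεs : ∀ l : Fin n, k + 1 < l → ε l = 0 := fun l hl =>
      Pi.single_eq_of_ne (fun h => by simp [h] at hl) _
    have hεu : ε ⬝ᵥ u = 0 := by rw [dotProduct_comm, huε]
    refine ⟨fun i => if i < k then w i else x • u + y • ε, -y • u + (x * (u ⬝ᵥ u)) • ε,
      ?_, ?_, ?_, ?_, ?_⟩
    · intro i hi j hj
      by_cases hik : i < k <;> by_cases hjk : j < k
      · simp [hik, hjk, hw]
      · simp [hik, hjk, hwu, hwε, show i ≠ j by omega]
      · simp [hik, hjk, dotProduct_comm _ (w j), hwu, hwε, show i ≠ j by omega]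
      · obtain rfl : i = k := by omega
        obtain rfl : j = i := by omega
        simp [huε, hεε, hεu]
        linear_combination hxy
    · intro i hi
      by_cases hik : i < k
      · simp [hik, hwu, hwε]
      · simp [hik, huε, hεε, hεu]
        ring
    · have : (-y • u + (x * (u ⬝ᵥ u)) • ε) ⬝ᵥ (-y • u + (x * (u ⬝ᵥ u)) • ε)
          = (u ⬝ᵥ u) * a k := by
        simp [huε, hεε, hεu]
        linear_combination (u ⬝ᵥ u) * hxy
      rw [this]
      exact mul_ne_zero hu (ha k)
    · intro i hi l hl
      by_cases hik : i < k
      · simp [hik, hws i hik l (by omega)]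
      · simp [hik, hus l (by omega), hεs l hl]
    · intro l hl
      simp [hus l (by omega), hεs l hl]

/-- Conjugation by a rectangular matrix `W` whose Gram matrix is invertible turns isometries of
the Gram matrix into orthogonal matrices. -/
theorem Matrix.pow_exponent_orthogonalGroup_eq_one {R ι κ : Type*} [CommRing R] [Fintype ι]
    [DecidableEq ι] [Fintype κ] [DecidableEq κ] {W : Matrix κ ι R} {D M : Matrix ι ι R}
    (hW : Wᵀ * W = D) (hD : IsUnit D) (hM : Mᵀ * D * M = D) :
    M ^ Monoid.exponent (orthogonalGroup κ R) = 1 := by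
  obtain ⟨E, hDE, hED⟩ : ∃ E, D * E = 1 ∧ E * D = 1 := by
    obtain ⟨u, rfl⟩ := hD
    exact ⟨↑u⁻¹, by simp, by simp⟩
  have hDt : Dᵀ = D := by rw [← hW]; simp
  have hEt : Eᵀ = E := by
    have h : Eᵀ * D = 1 := by rw [← hDt, ← transpose_mul, hDE, transpose_one]
    calc Eᵀ = Eᵀ * (D * E) := by rw [hDE, Matrix.mul_one]
      _ = E := by rw [← Matrix.mul_assoc, h, Matrix.one_mul]
  let φ : Matrix ι ι R → Matrix κ κ R := fun X => W * X * E * Wᵀ + (1 - W * E * Wᵀ)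
  have hφ (X Y : Matrix ι ι R) : φ X * φ Y = φ (X * Y) := by
    have h1 (Z : Matrix ι κ R) : Wᵀ * (W * Z) = D * Z := by rw [← Matrix.mul_assoc, hW]
    have h2 (Z : Matrix ι κ R) : E * (D * Z) = Z := by rw [← Matrix.mul_assoc, hED, Matrix.one_mul]
    simp only [φ, Matrix.add_mul, Matrix.mul_add, Matrix.sub_mul, Matrix.mul_sub, Matrix.mul_one,
      Matrix.one_mul, Matrix.mul_assoc, h1, h2]
    abel
  have hφ1 : φ 1 = 1 := by simp [φ]
  have hφpow (k : ℕ) : φ M ^ k = φ (M ^ k) := by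
    induction k with
    | zero => simp [hφ1]
    | succ k ih => rw [pow_succ, ih, hφ, pow_succ]
  have hφt : (φ M)ᵀ = φ (E * Mᵀ * D) := by
    have h3 (Z : Matrix ι κ R) : D * (E * Z) = Z := by rw [← Matrix.mul_assoc, hDE, Matrix.one_mul]
    simp [φ, hEt, Matrix.mul_assoc, h3]
  have hmem : φ M ∈ orthogonalGroup κ R := by
    rw [mem_orthogonalGroup_iff', hφt, hφ, Matrix.mul_assoc, Matrix.mul_assoc, ← Matrix.mul_assoc Mᵀ, hM, hED, hφ1]
  have hpow : φ (M ^ Monoid.exponent (orthogonalGroup κ R)) = 1 := by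
    rw [← hφpow]
    simpa using congrArg Subtype.val
      (Monoid.pow_exponent_eq_one (⟨φ M, hmem⟩ : orthogonalGroup κ R))
  have hinj (X : Matrix ι ι R) : E * Wᵀ * φ X * W = X := by
    have h1 : Wᵀ * W = D := hW
    have h1' (Z : Matrix ι ι R) : Wᵀ * (W * Z) = D * Z := by rw [← Matrix.mul_assoc, hW]
    have h2 (Z : Matrix ι ι R) : E * (D * Z) = Z := by rw [← Matrix.mul_assoc, hED, Matrix.one_mul]
    simp [φ, Matrix.add_mul, Matrix.mul_add, Matrix.sub_mul, Matrix.mul_sub, Matrix.mul_assoc,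
      h1, h1', h2, hED]
  rw [← hinj (M ^ _), hpow]
  simp [Matrix.mul_assoc, hW, hED]

/-- An isometry of a nondegenerate symmetric form on a space of dimension less than `n` over a
finite field of odd order is killed by the exponent of the orthogonal group in dimension `n`. -/
theorem LinearMap.pow_exponent_orthogonalGroup_eq_one {F V : Type*} [Field F] [Fintype F]
    (hF : Fintype.card F % 2 = 1) [AddCommGroup V] [Module F V] [FiniteDimensional F V]
    {n : ℕ} (hn : Module.finrank F V < n) (B : LinearMap.BilinForm F V) (hB : ∀ x y, B x y = B y x)
    (hB' : ∀ x, (∀ y, B x y = 0) → x = 0) (g : V →ₗ[F] V) (hg : ∀ x y, B (g x) (g y) = B x y) :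
    g ^ Monoid.exponent (orthogonalGroup (Fin n) F) = 1 := by
  have h2 : (2 : F) ≠ 0 := Ring.two_ne_zero fun h => by
    have := FiniteField.even_card_of_char_two h
    omega
  have := invertibleOfNonzero h2
  obtain ⟨b, hb⟩ := LinearMap.BilinForm.exists_orthogonal_basis (B := B) ⟨hB⟩
  have ha := hb.not_isOrtho_basis_self_of_separatingLeft hB'
  obtain ⟨w, hw⟩ := FiniteField.exists_orthogonal_family hF (n := n)
    (fun i => if h : i < Module.finrank F V then B (b ⟨i, h⟩) (b ⟨i, h⟩) else 1)
    (fun i => by split_ifs with h; exacts [ha _, one_ne_zero]) hn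
  let D : Matrix (Fin (Module.finrank F V)) (Fin (Module.finrank F V)) F :=
    LinearMap.BilinForm.toMatrix b B
  have hbb (i j) : B (b i) (b j) = if i = j then B (b i) (b i) else 0 := by
    split_ifs with h
    · rw [h]
    · exact hb h
  have hM := Matrix.pow_exponent_orthogonalGroup_eq_one (κ := Fin n)
    (W := Matrix.of fun l (i : Fin (Module.finrank F V)) => w i l) (D := D)
    (M := LinearMap.toMatrix b b g) ?_ ?_ ?_
  · apply (LinearMap.toMatrixAlgEquiv b).injective
    rw [map_pow, map_one]
    exact hM
  · ext i j
    have := hw i i.2 j j.2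
    simp only [Fin.is_lt, dite_true, Fin.eta, Fin.val_inj] at this
    simp only [D, LinearMap.BilinForm.toMatrix_apply]
    rw [hbb, ← this]
    rfl
  · have : D = Matrix.diagonal fun i => B (b i) (b i) := by
      ext i j
      simp only [D, LinearMap.BilinForm.toMatrix_apply, Matrix.diagonal_apply]
      exact hbb i j
    rw [this, Matrix.isUnit_diagonal, Pi.isUnit_iff]
    exact fun i => (ha i).isUnit
  · rw [← LinearMap.BilinForm.toMatrix_comp b b]
    congr 1
    ext x y
    simp [hg]

open Polynomial in
/-- A matrix of order `p ^ (k + 1)`, with `p` invertible, has an eigenvalue of that order. -/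
theorem Matrix.exists_isPrimitiveRoot_aeval_charpoly_eq_zero {F Ω κ : Type*} [Field F] [Field Ω]
    [IsAlgClosed Ω] [Algebra F Ω] [Fintype κ] [DecidableEq κ] {p k : ℕ} (hp : p.Prime)
    (hpF : (p : F) ≠ 0) {A : Matrix κ κ F} (hA : A ^ p ^ (k + 1) = 1) (hA' : A ^ p ^ k ≠ 1) :
    ∃ ζ : Ω, IsPrimitiveRoot ζ (p ^ (k + 1)) ∧ aeval ζ A.charpoly = 0 := by
  have := Fact.mk hp
  have hpΩ : (p : Ω) ≠ 0 := by
    rw [← map_natCast (algebraMap F Ω)]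
    exact (_root_.map_ne_zero _).2 hpF
  have : NeZero ((p ^ (k + 1) : ℕ) : Ω) := ⟨by simp [hpΩ]⟩
  have hdvd : minpoly F A ∣ cyclotomic (p ^ (k + 1)) F * (X ^ p ^ k - 1) := by
    rw [cyclotomic_prime_pow_mul_X_pow_sub_one]
    exact minpoly.dvd _ _ (by simp [hA])
  have hnot : ¬ IsCoprime (minpoly F A) (cyclotomic (p ^ (k + 1)) F) := fun h => hA' <| by
    obtain ⟨f, hf⟩ := h.dvd_of_dvd_mul_left hdvd
    simpa [sub_eq_zero] using congrArg (aeval A) hf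
  rw [isCoprime_iff_aeval_ne_zero_of_isAlgClosed F Ω] at hnot
  push Not at hnot
  obtain ⟨ζ, h1, h2⟩ := hnot
  refine ⟨ζ, ?_, ?_⟩
  · rwa [← isRoot_cyclotomic_iff, IsRoot.def, ← map_cyclotomic _ (algebraMap F Ω),
      eval_map_algebraMap]
  · exact aeval_eq_zero_of_dvd_aeval_eq_zero (minpoly_dvd_charpoly A) h1

open Polynomial in
/-- The eigenvalues of an orthogonal matrix are closed under inversion. -/
theorem Matrix.aeval_inv_charpoly_eq_zero {F Ω κ : Type*} [Field F] [Field Ω] [Algebra F Ω]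
    [Fintype κ] [DecidableEq κ] {A : Matrix κ κ F} (hA : Aᵀ * A = 1) {ζ : Ω} (hζ : ζ ≠ 0)
    (h : aeval ζ A.charpoly = 0) : aeval ζ⁻¹ A.charpoly = 0 := by
  rw [← eval_map_algebraMap, ← charpoly_map, eval_charpoly] at h ⊢
  set C := A.map (algebraMap F Ω) with hC
  have hCC : Cᵀ * C = 1 := by
    rw [hC, ← transpose_map, ← Matrix.map_mul, hA, Matrix.map_one _ (map_zero _) (map_one _)]
  have key : (scalar κ ζ⁻¹ - C)ᵀ * C = -scalar κ ζ⁻¹ * (scalar κ ζ - C) := by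
    have : scalar κ ζ⁻¹ * scalar κ ζ = 1 := by
      rw [← map_mul, inv_mul_cancel₀ hζ, map_one]
    rw [transpose_sub, Matrix.sub_mul, hCC, Matrix.mul_sub, Matrix.neg_mul, Matrix.neg_mul, this]
    simp only [scalar_apply, diagonal_transpose]
    abel
  have hdet := congrArg det key
  rw [det_mul, det_mul, h, mul_zero, det_transpose] at hdet
  refine (mul_eq_zero.1 hdet).resolve_right fun h0 => ?_
  simpa [h0] using congrArg det hCC

open Polynomial in
theorem FiniteField.aeval_pow_card_pow_eq_zero {F Ω : Type*} [Field F] [Fintype F] [Field Ω]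
    [Algebra F Ω] {f : F[X]} {ζ : Ω} (h : aeval ζ f = 0) (i : ℕ) :
    aeval (ζ ^ Fintype.card F ^ i) f = 0 := by
  induction i with
  | zero => simpa using h
  | succ i ih =>
    rw [pow_succ, pow_mul, ← expand_aeval, FiniteField.expand_card, map_pow, ih,
      zero_pow Fintype.card_ne_zero]

theorem Polynomial.card_le_natDegree_of_aeval_injOn {F Ω ι : Type*} [Field F] [Field Ω]
    [Algebra F Ω] {f : Polynomial F} (hf : f ≠ 0) (s : Finset ι) (φ : ι → Ω)
    (hφ : Set.InjOn φ s) (h : ∀ i ∈ s, aeval (φ i) f = 0) : s.card ≤ f.natDegree := by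
  classical
  have h1 : s.card ≤ (f.aroots Ω).toFinset.card :=
    Finset.card_le_card_of_injOn φ (fun i hi => by simpa [hf] using h i hi) hφ
  exact h1.trans ((Multiset.toFinset_card_le _).trans
    ((card_roots' _).trans natDegree_map_le))

theorem eq_of_pow_pow_eq_pow_pow {G : Type*} [LeftCancelMonoid G] {ζ : G} {p q k N : ℕ}
    (hpq : (p ^ k).Coprime q) (hq : 0 < q) (hζ : orderOf ζ = p ^ k)
    (hN : ∀ t, p ^ k ∣ q ^ t - 1 → N ∣ t) {i j : ℕ} (hi : i < N) (hj : j < N)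
    (h : ζ ^ q ^ i = ζ ^ q ^ j) : i = j := by
  wlog hij : i ≤ j generalizing i j
  · exact (this hj hi h.symm (by omega)).symm
  obtain ⟨t, rfl⟩ := Nat.exists_eq_add_of_le hij
  rw [pow_eq_pow_iff_modEq, hζ, Nat.modEq_iff_dvd' (Nat.pow_le_pow_right hq hij), pow_add] at h
  have h' : p ^ k ∣ q ^ i * (q ^ t - 1) := by rwa [Nat.mul_sub, mul_one]
  have := Nat.eq_zero_of_dvd_of_lt (hN t ((hpq.pow_right i).dvd_of_dvd_mul_left h')) (by omega)
  omega

theorem pow_pow_mul_pow_pow_ne_one {G : Type*} [Monoid G] {ζ : G} {p q k N : ℕ}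
    (hpk : 2 < p ^ k) (hpq : (p ^ k).Coprime q) (hζ : orderOf ζ = p ^ k)
    (hN : ∀ t, p ^ k ∣ q ^ t - 1 → N ∣ t) (hodd : Odd N) {i j : ℕ} (hi : i < N) (hj : j < N) :
    ζ ^ q ^ i * ζ ^ q ^ j ≠ 1 := by
  intro h
  wlog hij : i ≤ j generalizing i j
  · exact this hj hi (by rwa [← pow_add, add_comm, pow_add]) (by omega)
  obtain ⟨t, rfl⟩ := Nat.exists_eq_add_of_le hij
  rw [← pow_add, ← orderOf_dvd_iff_pow_eq_one, hζ, pow_add] at h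
  have h' : p ^ k ∣ q ^ i * (1 + q ^ t) := by rwa [mul_add, mul_one]
  have h1 : p ^ k ∣ 1 + q ^ t := (hpq.pow_right i).dvd_of_dvd_mul_left h'
  have h2 : N ∣ 2 * t := by
    apply hN
    rw [mul_comm, pow_mul, show (1 : ℕ) = 1 ^ 2 by norm_num, Nat.sq_sub_sq, add_comm]
    exact h1.mul_right _
  have h3 := Nat.eq_zero_of_dvd_of_lt
    ((Nat.Coprime.symm (Nat.coprime_two_left.2 hodd)).dvd_of_dvd_mul_left h2) (by omega)
  subst h3
  exact absurd (Nat.le_of_dvd (by norm_num) h1) (by simpa using hpk)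

theorem Matrix.not_pow_dvd_exponent_orthogonalGroup {F κ : Type*} [Field F] [Fintype F]
    [Fintype κ] [DecidableEq κ] {p k N : ℕ} (hp : p.Prime) (hodd : Odd p)
    (hpF : ¬ p ∣ Fintype.card F)
    (hN : ∀ t, p ^ (k + 1) ∣ Fintype.card F ^ t - 1 → N ∣ t)
    (hκ : (if Odd N then 2 * N else N) > Fintype.card κ) :
    ¬ p ^ (k + 1) ∣ Monoid.exponent (orthogonalGroup κ F) := by
  intro hdvd
  have hpF' : (p : F) ≠ 0 := by
    have := Fact.mk hp
    exact ((isUnit_iff_not_dvd_char F p).2 fun h => hpF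
      ((prime_dvd_char_iff_dvd_card p).1 h)).ne_zero
  have hcop : (p ^ (k + 1)).Coprime (Fintype.card F) :=
    Nat.Coprime.pow_left _ ((Nat.Prime.coprime_iff_not_dvd hp).2 hpF)
  have hpk : 2 < p ^ (k + 1) := by
    have : 2 < p := lt_of_le_of_ne hp.two_le fun h => by
      rw [← h] at hodd
      exact absurd hodd (by decide)
    exact this.trans_le (Nat.le_self_pow (by omega) p)
  obtain ⟨g, hg⟩ := hp.exists_orderOf_eq_pow_factorization_exponent (orthogonalGroup κ F)
  have hle : k + 1 ≤ (Monoid.exponent (orthogonalGroup κ F)).factorization p :=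
    (hp.pow_dvd_iff_le_factorization Monoid.exponent_ne_zero_of_finite).1 hdvd
  obtain ⟨l, hl⟩ := Nat.exists_eq_add_of_le hle
  have hg' : orderOf (g ^ p ^ l) = p ^ (k + 1) := by
    rw [orderOf_pow_of_dvd (pow_ne_zero _ hp.ne_zero) (hg ▸ pow_dvd_pow p (by omega)), hg, hl,
      Nat.pow_div (by omega) hp.pos, Nat.add_sub_cancel]
  generalize g ^ p ^ l = g at hg'
  have hA : orderOf (g : Matrix κ κ F) = p ^ (k + 1) := by
    rw [← hg', ← orderOf_submonoid]
  obtain ⟨ζ, hζ, hroot⟩ := exists_isPrimitiveRoot_aeval_charpoly_eq_zero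
    (Ω := AlgebraicClosure F) hp hpF' (A := (g : Matrix κ κ F)) (k := k)
    (by rw [← hA, pow_orderOf_eq_one])
    (pow_ne_one_of_lt_orderOf (pow_ne_zero _ hp.ne_zero)
      (hA ▸ Nat.pow_lt_pow_right hp.one_lt (by omega)))
  have hζ0 : ζ ≠ 0 := hζ.ne_zero (by omega)
  have hζo : orderOf ζ = p ^ (k + 1) := hζ.eq_orderOf.symm
  have hζu : orderOf (Units.mk0 ζ hζ0) = p ^ (k + 1) := by rw [← orderOf_units, Units.val_mk0, hζo]
  have hf : (g : Matrix κ κ F).charpoly ≠ 0 := (charpoly_monic _).ne_zero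
  have hr := FiniteField.aeval_pow_card_pow_eq_zero hroot
  have hr' (i : ℕ) := aeval_inv_charpoly_eq_zero ((mem_orthogonalGroup_iff' κ F).1 g.2)
    (pow_ne_zero _ hζ0) (hr i)
  have hinj {i j : ℕ} (hi : i < N) (hj : j < N)
      (h : ζ ^ Fintype.card F ^ i = ζ ^ Fintype.card F ^ j) : i = j :=
    eq_of_pow_pow_eq_pow_pow hcop Fintype.card_pos hζu hN hi hj (Units.ext (by simpa using h))
  rw [← charpoly_natDegree_eq_dim (g : Matrix κ κ F)] at hκ
  split_ifs at hκ with hNodd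
  · refine hκ.not_ge ?_
    have hne {i j : ℕ} := pow_pow_mul_pow_pow_ne_one hpk hcop hζo hN hNodd (i := i) (j := j)
    have := Polynomial.card_le_natDegree_of_aeval_injOn hf
      (Finset.range N ×ˢ (Finset.univ : Finset Bool))
      (fun x => bif x.2 then ζ ^ Fintype.card F ^ x.1 else (ζ ^ Fintype.card F ^ x.1)⁻¹) ?_ ?_
    · simpa [mul_comm] using this
    · rintro ⟨i, b⟩ hi ⟨j, c⟩ hj h
      simp only [Finset.coe_product, Set.mem_prod, Finset.mem_coe, Finset.mem_range] at hi hj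
      cases b <;> cases c <;> simp only [cond_true, cond_false] at h
      · rw [hinj hi.1 hj.1 (inv_injective h)]
      · refine absurd ?_ (hne hi.1 hj.1)
        rw [← h, mul_inv_cancel₀ (pow_ne_zero _ hζ0)]
      · refine absurd ?_ (hne hi.1 hj.1)
        rw [h, inv_mul_cancel₀ (pow_ne_zero _ hζ0)]
      · rw [hinj hi.1 hj.1 h]
    · rintro ⟨i, b⟩ -
      cases b
      · exact hr' i
      · exact hr i
  · refine hκ.not_ge ?_
    have := Polynomial.card_le_natDegree_of_aeval_injOn hf (Finset.range N)
      (fun i => ζ ^ Fintype.card F ^ i)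
      (fun i hi j hj h => hinj (by simpa using hi) (by simpa using hj) h) fun i _ => hr i
    simpa using this

theorem FiniteField.exists_extension_orderOf_eq (F : Type) [Field F] [Fintype F] {h d : ℕ}
    (hh : h ≠ 0) (hd : d ∣ Fintype.card F ^ h - 1) :
    ∃ (K : Type) (_ : Field K) (_ : Algebra F K), FiniteDimensional F K ∧
      Module.finrank F K = h ∧ ∃ ζ : K, orderOf ζ = d := by
  obtain ⟨p, hp⟩ := CharP.exists F
  have := Fact.mk (CharP.char_is_prime F p)
  have := NeZero.mk hh
  refine ⟨Extension F p h, inferInstance, inferInstance, inferInstance, finrank_extension F p h, ?_⟩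
  obtain ⟨u, hu⟩ := IsCyclic.exists_ofOrder_eq_natCard (α := (Extension F p h)ˣ)
  rw [Nat.card_units, natCard_extension, Nat.card_eq_fintype_card] at hu
  have h0 : Fintype.card F ^ h - 1 ≠ 0 :=
    Nat.sub_ne_zero_of_lt (Nat.one_lt_pow hh Fintype.one_lt_card)
  obtain ⟨c, hc⟩ := hd
  have hc0 : c ≠ 0 := by rintro rfl; simp [hc] at h0
  refine ⟨(u ^ c : (Extension F p h)ˣ), ?_⟩
  rw [orderOf_units, orderOf_pow_of_dvd hc0 (by rw [hu, hc]; exact dvd_mul_left _ _), hu, hc,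
    Nat.mul_div_cancel _ (Nat.pos_of_ne_zero hc0)]

theorem FiniteField.eq_zero_of_trace_mul_eq_zero {F K : Type*} [Field F] [Finite F] [Field K]
    [Algebra F K] [FiniteDimensional F K] {x : K} (h : ∀ y, Algebra.trace F K (x * y) = 0) :
    x = 0 :=
  (traceForm_nondegenerate F K).1 x h

theorem FiniteField.dvd_exponent_orthogonalGroup_of_dvd_pow_add_one {F : Type} [Field F]
    [Fintype F] (hF : Fintype.card F % 2 = 1) {h d n : ℕ} (hh : h ≠ 0) (hn : 2 * h < n)
    (hd : d ∣ Fintype.card F ^ h + 1) : d ∣ Monoid.exponent (orthogonalGroup (Fin n) F) := by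
  have hd' : d ∣ Fintype.card F ^ (2 * h) - 1 := by
    rw [mul_comm, pow_mul, show (1 : ℕ) = 1 ^ 2 by norm_num, Nat.sq_sub_sq]
    exact hd.mul_right _
  obtain ⟨K, _, _, _, hK, ζ, hζ⟩ := exists_extension_orderOf_eq F (mul_ne_zero two_ne_zero hh) hd'
  have := Module.finite_of_finite F (M := K)
  have := Fintype.ofFinite K
  let σ : K ≃ₐ[F] K := frobeniusAlgEquivOfAlgebraic F K ^ h
  have hσ (x : K) : σ x = x ^ Fintype.card F ^ h := by
    simp only [σ, AlgEquiv.coe_pow, coe_frobeniusAlgEquivOfAlgebraic_iterate]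
  have hσσ (x : K) : σ (σ x) = x := by
    rw [hσ, hσ, ← pow_mul, ← pow_add, ← two_mul, ← hK, ← Module.card_eq_pow_finrank,
      FiniteField.pow_card]
  have hζσ : ζ * σ ζ = 1 := by
    rw [hσ, ← pow_succ', ← orderOf_dvd_iff_pow_eq_one, hζ]
    exact hd
  have hpow := LinearMap.pow_exponent_orthogonalGroup_eq_one hF (hK.trans_lt hn)
    ((Algebra.traceForm F K).compl₂ σ.toLinearMap) ?_ ?_ (LinearMap.mulLeft F ζ) ?_
  · rw [LinearMap.pow_mulLeft] at hpow
    rw [← hζ]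
    exact orderOf_dvd_of_pow_eq_one (by simpa using LinearMap.congr_fun hpow 1)
  · intro x y
    simp only [LinearMap.compl₂_apply, Algebra.traceForm_apply, AlgEquiv.toLinearMap_apply]
    rw [← Algebra.trace_eq_of_algEquiv σ, map_mul, hσσ, mul_comm]
  · refine fun x hx => eq_zero_of_trace_mul_eq_zero (F := F) fun y => ?_
    simpa [hσσ] using hx (σ y)
  · intro x y
    simp only [LinearMap.compl₂_apply, Algebra.traceForm_apply, AlgEquiv.toLinearMap_apply,
      LinearMap.mulLeft_apply, map_mul]
    rw [mul_mul_mul_comm, hζσ, one_mul]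

theorem FiniteField.dvd_exponent_orthogonalGroup_of_dvd_pow_sub_one {F : Type} [Field F]
    [Fintype F] (hF : Fintype.card F % 2 = 1) {h d n : ℕ} (hh : h ≠ 0) (hn : 2 * h < n)
    (hd : d ∣ Fintype.card F ^ h - 1) : d ∣ Monoid.exponent (orthogonalGroup (Fin n) F) := by
  obtain ⟨K, _, _, _, hK, ζ, hζ⟩ := exists_extension_orderOf_eq F hh hd
  have hζ0 : ζ ≠ 0 := by
    rintro rfl
    have h0 : Fintype.card F ^ h - 1 ≠ 0 :=
      Nat.sub_ne_zero_of_lt (Nat.one_lt_pow hh Fintype.one_lt_card)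
    rw [orderOf_zero] at hζ
    exact h0 (Nat.eq_zero_of_zero_dvd (hζ ▸ hd))
  let T := Algebra.traceForm F K
  let π₁ := LinearMap.fst F K K
  let π₂ := LinearMap.snd F K K
  have hpow := LinearMap.pow_exponent_orthogonalGroup_eq_one hF (V := K × K) (n := n)
    (by rw [Module.finrank_prod, hK]; omega)
    (T.compl₁₂ π₁ π₂ + T.compl₁₂ π₂ π₁) ?_ ?_
    ((LinearMap.mulLeft F ζ).prodMap (LinearMap.mulLeft F ζ⁻¹)) ?_
  · have hg (k : ℕ) : (((LinearMap.mulLeft F ζ).prodMap (LinearMap.mulLeft F ζ⁻¹)) ^ k) (1, 0)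
        = (ζ ^ k, 0) := by
      induction k with
      | zero => simp
      | succ k ih => simp [pow_succ', ih]
    rw [← hζ]
    refine orderOf_dvd_of_pow_eq_one ?_
    simpa [hg] using LinearMap.congr_fun hpow (1, 0)
  · rintro ⟨x, x'⟩ ⟨y, y'⟩
    simp [T, π₁, π₂, mul_comm, add_comm]
  · rintro ⟨x, x'⟩ hx
    refine Prod.ext (eq_zero_of_trace_mul_eq_zero (F := F) fun y => ?_)
      (eq_zero_of_trace_mul_eq_zero (F := F) fun y => ?_)
    · simpa [T, π₁, π₂] using hx (0, y)
    · simpa [T, π₁, π₂] using hx (y, 0)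
  · rintro ⟨x, x'⟩ ⟨y, y'⟩
    have h1 (a b : K) : ζ * a * (ζ⁻¹ * b) = a * b := by field_simp
    have h2 (a b : K) : ζ⁻¹ * a * (ζ * b) = a * b := by field_simp
    simp [T, π₁, π₂, h1, h2]

end

/-- Let `p` be an odd prime not dividing the odd prime power `q`, let `e` be the
multiplicative order of `q` mod `p`, let `p^r` exactly divide `q^e - 1`, and `m ≥ 1`.
If `e` is even and `e·p^v ≤ 2m+1 < e·p^(v+1)`, then the `p`-part of the exponent of
`O_{2m+1}(F_q)` is `p^(r+v)`; if `e` is odd and `2e·p^v ≤ 2m < 2e·p^(v+1)`, then the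
`p`-part of the exponent of `O_{2m+1}(F_q)` is `p^(r+v)`. -/
theorem exponent_p_part_orthogonalGroup_odd_dim (p q : ℕ) (hp : p.Prime)
    (hodd : Odd p) (hq : IsPrimePow q) (hqodd : Odd q) (hpq : ¬ p ∣ q)
    (F : Type) [Field F] [Fintype F] (hF : Fintype.card F = q)
    (e r m : ℕ) (he : orderOf (q : ZMod p) = e)
    (hr : p ^ r ∣ q ^ e - 1 ∧ ¬ p ^ (r + 1) ∣ q ^ e - 1) (hm : 1 ≤ m) :
    (Even e → ∀ v : ℕ, e * p ^ v ≤ 2 * m + 1 → 2 * m + 1 < e * p ^ (v + 1) →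
      p ^ (r + v) ∣ Monoid.exponent (Matrix.orthogonalGroup (Fin (2 * m + 1)) F) ∧
        ¬ p ^ (r + v + 1) ∣
            Monoid.exponent (Matrix.orthogonalGroup (Fin (2 * m + 1)) F)) ∧
    (Odd e → ∀ v : ℕ, 2 * e * p ^ v ≤ 2 * m → 2 * m < 2 * e * p ^ (v + 1) →
      p ^ (r + v) ∣ Monoid.exponent (Matrix.orthogonalGroup (Fin (2 * m + 1)) F) ∧
        ¬ p ^ (r + v + 1) ∣
            Monoid.exponent (Matrix.orthogonalGroup (Fin (2 * m + 1)) F)) := by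
  subst hF he
  have hF2 : Fintype.card F % 2 = 1 := Nat.odd_iff.1 hqodd
  have hord := Nat.pow_add_dvd_pow_sub_one_iff hp hodd hpq hr.1 hr.2
  have hdvd := Nat.dvd_pow_sub_one_iff_orderOf_dvd (p := p) Fintype.card_pos (q := Fintype.card F)
  have he0 : 0 < orderOf (Fintype.card F : ZMod p) := by
    have := Fact.mk hp
    have h0 : (Fintype.card F : ZMod p) ≠ 0 := by rwa [Ne, CharP.cast_eq_zero_iff (ZMod p) p]
    rw [← Units.val_mk0 h0, orderOf_units]
    exact orderOf_pos _
  generalize orderOf (Fintype.card F : ZMod p) = e at *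
  have hpv (v : ℕ) : 0 < p ^ v := pow_pos hp.pos v
  have hN (v t : ℕ) : p ^ (r + v + 1) ∣ Fintype.card F ^ t - 1 → e * p ^ (v + 1) ∣ t :=
    (hord (v + 1) t).1
  refine ⟨fun hev v hv hv' => ⟨?_, ?_⟩, fun hev v hv hv' => ⟨?_, ?_⟩⟩
  · obtain ⟨c, rfl⟩ := hev
    have hc : 0 < c := by omega
    rw [← two_mul, mul_assoc] at hv
    refine FiniteField.dvd_exponent_orthogonalGroup_of_dvd_pow_add_one hF2
      (mul_pos hc (hpv v)).ne' (n := 2 * m + 1) (by omega) ?_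
    have hmul : p ^ (r + v) ∣
        (Fintype.card F ^ (c * p ^ v) + 1) * (Fintype.card F ^ (c * p ^ v) - 1) := by
      rw [← Nat.sq_sub_sq, one_pow, ← pow_mul, hord]
      exact dvd_of_eq (by ring)
    refine Nat.Coprime.dvd_of_dvd_mul_right (Nat.Coprime.pow_left _ ?_) hmul
    refine (Nat.Prime.coprime_iff_not_dvd hp).2 fun h => ?_
    have h2 : c * 2 ∣ c * p ^ v := by rw [mul_two]; exact (hdvd _).1 h
    exact Nat.not_even_iff_odd.2 (hodd.pow (n := v))
      (even_iff_two_dvd.2 (Nat.dvd_of_mul_dvd_mul_left hc h2))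
  · refine Matrix.not_pow_dvd_exponent_orthogonalGroup hp hodd hpq (hN v) ?_
    rwa [if_neg (Nat.not_odd_iff_even.2 (hev.mul_right _)), Fintype.card_fin]
  · rw [mul_assoc] at hv
    exact FiniteField.dvd_exponent_orthogonalGroup_of_dvd_pow_sub_one hF2
      (mul_pos he0 (hpv v)).ne' (by omega) ((hord v _).2 dvd_rfl)
  · refine Matrix.not_pow_dvd_exponent_orthogonalGroup hp hodd hpq (hN v) ?_
    rw [if_pos (hev.mul hodd.pow), Fintype.card_fin]
    rw [mul_assoc] at hv'
    omega
end

section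
/- Let p be an odd prime, q = p^k a power of p, and m ≥ 1. Let a be the least natural number with p^a > 2m − 1. Then exp_p(O_{2m+1}(F_q)) = p^a. -/
open Matrix in
/-- If `-1` is a sum of two squares, then `⟨±1, …, ±1⟩` with an even number of minus signs is
congruent to the standard form. -/
lemma exists_transpose_mul_self_eq_diagonal {R ι : Type*} [CommRing R] [Fintype ι] [DecidableEq ι]
    {x y : R} (hxy : x ^ 2 + y ^ 2 = -1) (s : ι → Prop) [DecidablePred s]
    (hs : Even (Fintype.card {i // s i})) :
    ∃ P : Matrix ι ι R, Pᵀ * P = diagonal fun i => if s i then -1 else 1 := by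
  obtain ⟨c, hc⟩ := hs
  have e : {i // s i} ≃ Fin 2 × Fin c := Fintype.equivOfCardEq (by simp [hc, two_mul])
  let e' : ι ≃ (Fin 2 × Fin c) ⊕ {i // ¬ s i} :=
    (Equiv.sumCompl s).symm.trans (e.sumCongr (Equiv.refl _))
  let B : Matrix (Fin 2 × Fin c) (Fin 2 × Fin c) R := blockDiagonal fun _ => !![x, y; -y, x]
  have hB : Bᵀ * B = diagonal fun _ => -1 := by
    rw [blockDiagonal_transpose, ← blockDiagonal_mul,
      ← blockDiagonal_diagonal fun (_ : Fin c) (_ : Fin 2) => (-1 : R)]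
    congr 1
    funext _
    ext i j
    fin_cases i <;> fin_cases j <;> simp [mul_apply, Fin.sum_univ_two] <;>
      first | linear_combination hxy | ring
  refine ⟨(fromBlocks B 0 0 1).submatrix e' e', ?_⟩
  rw [transpose_submatrix, submatrix_mul_equiv, fromBlocks_transpose, fromBlocks_multiply]
  simp only [hB, transpose_zero, Matrix.zero_mul, Matrix.mul_zero, add_zero, zero_add,
    transpose_one, Matrix.mul_one]
  rw [← diagonal_one, fromBlocks_diagonal, submatrix_diagonal_equiv]
  congr 1
  rw [← e'.symm.surjective.injective_comp_right.eq_iff]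
  funext z
  rcases z with z | z
  · simp [e', (e.symm z).2]
  · simp [e', z.2]

namespace Matrix

variable {R : Type*} [CommRing R]

/-- The nilpotent Jordan block, with ones just above the diagonal. -/
def nilpotentJordan (R : Type*) [CommRing R] (n : ℕ) : Matrix (Fin n) (Fin n) R :=
  of fun i j => if (i : ℕ) + 1 = j then 1 else 0

/-- The antidiagonal matrix with alternating signs. -/
def alternatingAntidiagonal (R : Type*) [CommRing R] (n : ℕ) : Matrix (Fin n) (Fin n) R :=
  of fun i j => if j = i.rev then (-1) ^ (i : ℕ) else 0

lemma nilpotentJordan_pow (n k : ℕ) :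
    nilpotentJordan R n ^ k = of fun i j : Fin n => if (i : ℕ) + k = j then 1 else 0 := by
  induction k with
  | zero => ext i j; simp [one_apply, Fin.ext_iff]
  | succ k ih =>
    ext i j
    rw [pow_succ, ih, mul_apply]
    simp only [nilpotentJordan, of_apply, ite_mul, one_mul, zero_mul, ← ite_and]
    by_cases h : (i : ℕ) + (k + 1) = j
    · rw [Finset.sum_eq_single ⟨i + k, by omega⟩]
      · simp [h]; omega
      · intro b _ hb
        rw [if_neg]
        rintro ⟨h1, -⟩
        exact hb (Fin.ext h1.symm)
      · simp
    · rw [if_neg h]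
      exact Finset.sum_eq_zero fun b _ => if_neg (by omega)

lemma nilpotentJordan_pow_self (n : ℕ) : nilpotentJordan R n ^ n = 0 := by
  ext i j
  rw [nilpotentJordan_pow]
  simp; omega

lemma nilpotentJordan_pow_ne_zero [Nontrivial R] {n k : ℕ} (hk : k < n) :
    nilpotentJordan R n ^ k ≠ 0 := by
  intro h
  rw [nilpotentJordan_pow] at h
  simpa using congr_fun₂ h ⟨0, by omega⟩ ⟨k, hk⟩

lemma alternatingAntidiagonal_mul_self {n : ℕ} (hn : Odd n) :
    alternatingAntidiagonal R n * alternatingAntidiagonal R n = 1 := by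
  ext i j
  simp only [alternatingAntidiagonal, mul_apply, of_apply, ite_mul, zero_mul, Finset.sum_ite_eq',
    Finset.mem_univ, if_true, Fin.rev_rev, one_apply, eq_comm (a := j)]
  split_ifs with h
  · rw [← pow_add]
    apply Even.neg_one_pow
    have := i.2
    grind
  · rw [mul_zero]

lemma alternatingAntidiagonal_mul_transpose_nilpotentJordan (n : ℕ) :
    alternatingAntidiagonal R n * (nilpotentJordan R n)ᵀ =
      -(nilpotentJordan R n * alternatingAntidiagonal R n) := by
  ext i j
  simp only [alternatingAntidiagonal, nilpotentJordan, mul_apply, of_apply, ite_mul, zero_mul,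
    Finset.sum_ite_eq', Finset.mem_univ, if_true, transpose_apply, neg_apply, one_mul,
    eq_comm (a := j), Fin.rev_eq_iff]
  rw [Finset.sum_eq_single j.rev (by simp +contextual) (by simp)]
  simp only [if_true]
  have hi := i.2
  have hj := j.2
  by_cases h : (i : ℕ) + j + 2 = n
  · rw [if_pos (by rw [Fin.val_rev]; omega), if_pos (by rw [Fin.val_rev]; omega), mul_one,
      Fin.val_rev]
    have hpar : n - (j + 1) = (i : ℕ) + 1 := by omega
    rw [hpar, pow_succ]
    ring
  · rw [if_neg (by rw [Fin.val_rev]; omega), if_neg (by rw [Fin.val_rev]; omega)]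
    simp

/-- Over a field in which `-1` is a sum of two squares, the standard form in odd dimension
is congruent to the alternating antidiagonal form. -/
lemma exists_transpose_mul_self_eq_alternatingAntidiagonal {K : Type*} [Field K]
    (h2 : (2 : K) ≠ 0) {x y : K} (hxy : x ^ 2 + y ^ 2 = -1) {m : ℕ} (hm : 1 ≤ m) :
    ∃ P : Matrix (Fin (2 * m + 1)) (Fin (2 * m + 1)) K,
      Pᵀ * P = alternatingAntidiagonal K (2 * m + 1) := by
  set c := m + 1 - m % 2 with hc
  have hcm : c < 2 * m + 1 := by omega
  obtain ⟨P, hP⟩ := exists_transpose_mul_self_eq_diagonal hxy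
    (fun i : Fin (2 * m + 1) => ⟨c, hcm⟩ ≤ i) (by
      rw [Fintype.card_subtype, show ({i | ⟨c, hcm⟩ ≤ i} : Finset (Fin (2 * m + 1))) =
        Finset.Ici ⟨c, hcm⟩ by ext; simp, Fin.card_Ici]
      rw [Nat.even_iff]
      simp only
      omega)
  let α : Fin (2 * m + 1) → K := fun j => if (j : ℕ) ≤ m then 1 else -(-1) ^ (j : ℕ) / 2
  let β : Fin (2 * m + 1) → K := fun j =>
    if (j : ℕ) < m then 1 else if (j : ℕ) = m then 0 else (-1) ^ (j : ℕ) / 2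
  let Q : Matrix (Fin (2 * m + 1)) (Fin (2 * m + 1)) K :=
    of fun l j => (if l = j then α j else 0) + (if l = j.rev then β j else 0)
  refine ⟨P * Q, ?_⟩
  rw [transpose_mul, Matrix.mul_assoc, ← Matrix.mul_assoc _ P, hP]
  ext i j
  rw [mul_apply]
  simp only [diagonal_mul, transpose_apply, Q, of_apply, add_mul, mul_add, ite_mul, mul_ite,
    zero_mul, mul_zero, Finset.sum_add_distrib, Finset.sum_ite_eq',
    Finset.mem_univ, if_true, alternatingAntidiagonal]
  have hi := i.2
  have hj := j.2
  by_cases hji : j = i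
  · subst hji
    rcases lt_trichotomy (j : ℕ) m with h | h | h
    · have hr : j.rev ≠ j := by rw [Ne, Fin.ext_iff, Fin.val_rev]; omega
      have hc1 : ¬ (⟨c, hcm⟩ ≤ j) := by rw [Fin.le_def]; simp only; omega
      have hc2 : ⟨c, hcm⟩ ≤ j.rev := by rw [Fin.le_def, Fin.val_rev]; simp only; omega
      simp [hr, hr.symm, hc1, hc2, α, β, h, h.le]
    · have hr : j.rev = j := by rw [Fin.ext_iff, Fin.val_rev]; omega
      rcases Nat.even_or_odd m with hp | hp
      · have hc1 : ¬ (⟨c, hcm⟩ ≤ j) := by rw [Fin.le_def]; simp only; grind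
        simp [hr, hc1, α, β, h, hp.neg_one_pow]
      · have hc1 : ⟨c, hcm⟩ ≤ j := by rw [Fin.le_def]; simp only; grind
        simp [hr, hc1, α, β, h, hp.neg_one_pow]
    · have hr : j.rev ≠ j := by rw [Ne, Fin.ext_iff, Fin.val_rev]; omega
      have hc1 : ⟨c, hcm⟩ ≤ j := by rw [Fin.le_def]; simp only; omega
      have hc2 : ¬ (⟨c, hcm⟩ ≤ j.rev) := by rw [Fin.le_def, Fin.val_rev]; simp only; omega
      simp [hr, hr.symm, hc1, hc2, α, β, h.not_gt, h.not_ge, h.ne']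
      ring
  · by_cases hr : j = i.rev
    · subst hr
      have hv := Fin.val_rev i
      rcases Nat.lt_or_gt_of_ne (show (i : ℕ) ≠ m by
        rintro h; apply hji; rw [Fin.ext_iff, Fin.val_rev]; omega) with h | h
      · have hc1 : ¬ (⟨c, hcm⟩ ≤ i) := by rw [Fin.le_def]; simp only; omega
        have hc2 : ⟨c, hcm⟩ ≤ i.rev := by rw [Fin.le_def]; simp only; omega
        simp [hji, Ne.symm hji, hc1, hc2, α, β, h, h.le]
        rw [if_neg (by omega), if_neg (by omega), if_neg (by omega),
          neg_one_pow_congr (show Even (2 * m - (i : ℕ)) ↔ Even (i : ℕ) by grind)]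
        field_simp
        ring
      · have hc1 : ⟨c, hcm⟩ ≤ i := by rw [Fin.le_def]; simp only; omega
        have hc2 : ¬ (⟨c, hcm⟩ ≤ i.rev) := by rw [Fin.le_def]; simp only; omega
        simp [hji, Ne.symm hji, hc1, hc2, α, β, h.not_gt, h.not_ge, h.ne']
        rw [if_pos (by omega), if_pos (by omega)]
        field_simp
        ring
    · have hr' : j.rev ≠ i := fun h => hr (Fin.rev_eq_iff.mp h)
      simp [hji, hr, hr']

/-- Over such a field there is a skew-symmetric regular nilpotent matrix in each odd dimension
at least three. -/
lemma exists_skew_nilpotent {K : Type*} [Field K]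
    (h2 : (2 : K) ≠ 0) {x y : K} (hxy : x ^ 2 + y ^ 2 = -1) {m : ℕ} (hm : 1 ≤ m) :
    ∃ S : Matrix (Fin (2 * m + 1)) (Fin (2 * m + 1)) K,
      Sᵀ = -S ∧ S ^ (2 * m + 1) = 0 ∧ ∀ k < 2 * m + 1, S ^ k ≠ 0 := by
  obtain ⟨P, hP⟩ := exists_transpose_mul_self_eq_alternatingAntidiagonal h2 hxy hm
  have hodd : Odd (2 * m + 1) := odd_two_mul_add_one m
  set G := alternatingAntidiagonal K (2 * m + 1)
  set N := nilpotentJordan K (2 * m + 1)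
  have hGG : G * G = 1 := alternatingAntidiagonal_mul_self hodd
  have hGN : G * Nᵀ = -(N * G) := alternatingAntidiagonal_mul_transpose_nilpotentJordan _
  have hG : Gᵀ = G := by rw [← hP, transpose_mul, transpose_transpose]
  have hinv : (G * Pᵀ) * P = 1 := by rw [Matrix.mul_assoc, hP, hGG]
  let u : (Matrix (Fin (2 * m + 1)) (Fin (2 * m + 1)) K)ˣ :=
    ⟨P, G * Pᵀ, mul_eq_one_comm.mp hinv, hinv⟩
  have hpow (k : ℕ) : (u.1 * N * u⁻¹.1) ^ k = u.1 * N ^ k * u⁻¹.1 :=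
    Units.conj_pow u N k
  refine ⟨u.1 * N * u⁻¹.1, ?_, ?_, fun k hk h => ?_⟩
  · change (P * N * (G * Pᵀ))ᵀ = -(P * N * (G * Pᵀ))
    rw [transpose_mul, transpose_mul, transpose_mul, hG, transpose_transpose]
    calc P * G * (Nᵀ * Pᵀ) = P * (G * Nᵀ) * Pᵀ := by simp only [Matrix.mul_assoc]
      _ = _ := by rw [hGN]; simp only [Matrix.mul_assoc, Matrix.mul_neg, Matrix.neg_mul]
  · rw [hpow, nilpotentJordan_pow_self, mul_zero, zero_mul]
  · rw [hpow, Units.mul_left_eq_zero, Units.mul_right_eq_zero] at h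
    exact nilpotentJordan_pow_ne_zero hk h

/-- The `p`-power order of a unipotent matrix in characteristic `p` is bounded in terms of its
size. -/
lemma pow_char_pow_eq_one_of_pow_eq_one {K n : Type*} [Field K] [Fintype n] [DecidableEq n]
    (p : ℕ) [Fact p.Prime] [CharP K p] {a b : ℕ} (ha : Fintype.card n ≤ p ^ a)
    {A : Matrix n n K} (hA : A ^ p ^ b = 1) : A ^ p ^ a = 1 := by
  cases isEmpty_or_nonempty n
  · exact Subsingleton.elim _ _
  have key (c : ℕ) : (A - 1) ^ p ^ c = A ^ p ^ c - 1 := by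
    rw [sub_pow_char_pow_of_commute _ _ (Commute.one_right A), one_pow]
  have hnil : IsNilpotent (A - 1) := ⟨p ^ b, by rw [key, hA, sub_self]⟩
  have h0 : (A - 1) ^ Fintype.card n = 0 := by
    have h := (A - 1).aeval_self_charpoly
    rw [sub_eq_zero.mp (isNilpotent_charpoly_sub_pow_of_isNilpotent hnil).eq_zero] at h
    simpa using h
  rw [← sub_eq_zero, ← key]
  exact pow_eq_zero_of_le ha h0

/-- The Cayley transform of a nilpotent skew-symmetric matrix in odd characteristic. -/
lemma exists_mem_orthogonalGroup_pow {K n : Type*} [Field K] [Fintype n] [DecidableEq n]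
    [Nonempty n] (p : ℕ) [Fact p.Prime] [CharP K p] (h2 : (2 : K) ≠ 0) {a : ℕ}
    {S : Matrix n n K} (hS : Sᵀ = -S) (ha : S ^ p ^ a = 0) :
    ∃ g ∈ orthogonalGroup n K, g ^ p ^ a = 1 ∧ ∀ b, g ^ p ^ b = 1 → S ^ p ^ b = 0 := by
  have hadd (c : ℕ) : (1 + S) ^ p ^ c = 1 + S ^ p ^ c := by
    rw [add_pow_char_pow_of_commute _ _ (Commute.one_left S), one_pow]
  have hsub (c : ℕ) : (1 - S) ^ p ^ c = 1 - S ^ p ^ c := by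
    rw [sub_pow_char_pow_of_commute _ _ (Commute.one_left S), one_pow]
  have hp0 : p ^ a ≠ 0 := pow_ne_zero _ (Fact.out : p.Prime).ne_zero
  obtain ⟨u, hu⟩ : IsUnit (1 + S) := .of_pow_eq_one (by rw [hadd, ha, add_zero]) hp0
  obtain ⟨v, hv⟩ : IsUnit (1 - S) := .of_pow_eq_one (by rw [hsub, ha, sub_zero]) hp0
  have huv : Commute u v := Units.ext (by
    simp only [Units.val_mul, hu, hv]; noncomm_ring)
  have hpow (c : ℕ) : (↑(u * v⁻¹) : Matrix n n K) ^ p ^ c = 1 ↔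
      1 + S ^ p ^ c = 1 - S ^ p ^ c := by
    rw [← hadd, ← hsub, ← hu, ← hv]
    norm_cast
    rw [huv.inv_right.mul_pow, inv_pow, Units.val_eq_one, mul_inv_eq_one]
  have hvT : ((v⁻¹ : (Matrix n n K)ˣ) : Matrix n n K)ᵀ = ↑(u⁻¹) := by
    rw [coe_units_inv, coe_units_inv, transpose_nonsing_inv, hu, hv]
    simp [hS]
  refine ⟨↑(u * v⁻¹), ?_, ?_, fun b hb => ?_⟩
  · rw [mem_orthogonalGroup_iff']
    change ((u * v⁻¹).1 : Matrix n n K)ᵀ * (u * v⁻¹).1 = 1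
    have huT : (u : Matrix n n K)ᵀ = v := by simp [hu, hv, hS, sub_eq_add_neg]
    rw [Units.val_mul, transpose_mul, hvT, huT]
    norm_cast
    rw [mul_assoc, ← mul_assoc v, ← huv.eq]
    simp
  · rw [hpow, ha]; simp
  · rw [hpow, sub_eq_add_neg, add_right_inj, eq_neg_iff_add_eq_zero, ← two_smul K] at hb
    exact (smul_eq_zero.mp hb).resolve_left h2

end Matrix

/-- Let `q = p^k` be a power of the odd prime `p`, `m ≥ 1`, and let `a` be the least
natural number with `p^a > 2m - 1`. Then the `p`-part of the exponent of
`O_{2m+1}(F_q)` is `p^a`. -/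
theorem exponent_p_part_orthogonalGroup_natural_char (p k q : ℕ) (hp : p.Prime)
    (hodd : Odd p) (hk : 1 ≤ k) (hq : q = p ^ k)
    (F : Type) [Field F] [Fintype F] (hF : Fintype.card F = q)
    (m a : ℕ) (hm : 1 ≤ m)
    (ha : 2 * m - 1 < p ^ a ∧ ∀ b : ℕ, 2 * m - 1 < p ^ b → a ≤ b) :
    p ^ a ∣ Monoid.exponent (Matrix.orthogonalGroup (Fin (2 * m + 1)) F) ∧
      ¬ p ^ (a + 1) ∣ Monoid.exponent (Matrix.orthogonalGroup (Fin (2 * m + 1)) F) := by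
  have : Fact p.Prime := ⟨hp⟩
  have : CharP F p := charP_of_card_eq_prime_pow (hF.trans hq)
  have h2 : (2 : F) ≠ 0 := Ring.two_ne_zero (by
    rw [ringChar.eq F p]; rintro rfl; exact absurd hodd (by decide))
  obtain ⟨x, y, hxy⟩ := CharP.sq_add_sq F p (-1)
  obtain ⟨ha, ha'⟩ := ha
  have hle : 2 * m + 1 ≤ p ^ a := by
    obtain ⟨t, ht⟩ := hodd.pow (n := a)
    omega
  constructor
  · obtain ⟨S, hS, hS0, hS1⟩ := Matrix.exists_skew_nilpotent h2 (by simpa using hxy) hm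
    obtain ⟨g, hg, hga, hgb⟩ := Matrix.exists_mem_orthogonalGroup_pow p h2 hS
      (pow_eq_zero_of_le hle hS0)
    cases a with
    | zero => simp
    | succ b =>
      have hb : p ^ b < 2 * m + 1 := by
        by_contra! h
        have := ha' b (by omega)
        omega
      rw [← orderOf_eq_prime_pow (x := (⟨g, hg⟩ : Matrix.orthogonalGroup _ F))
        (fun h => hS1 _ hb (hgb b (congrArg Subtype.val h))) (Subtype.ext hga)]
      exact Monoid.order_dvd_exponent _
  · intro h
    obtain ⟨g, hg⟩ := hp.exists_orderOf_eq_pow_factorization_exponent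
      (Matrix.orthogonalGroup (Fin (2 * m + 1)) F)
    have hne : Monoid.exponent (Matrix.orthogonalGroup (Fin (2 * m + 1)) F) ≠ 0 :=
      Monoid.exponent_ne_zero_of_finite
    have hcard : Fintype.card (Fin (2 * m + 1)) ≤ p ^ a := by simpa using hle
    have hga : (g : Matrix _ _ F) ^ p ^ a = 1 :=
      Matrix.pow_char_pow_eq_one_of_pow_eq_one p hcard
        (congrArg Subtype.val (hg ▸ pow_orderOf_eq_one g))
    have hdvd := orderOf_dvd_of_pow_eq_one (Subtype.ext hga : g ^ p ^ a = 1)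
    rw [hg, Nat.pow_dvd_pow_iff_le_right hp.one_lt] at hdvd
    have := (hp.pow_dvd_iff_le_factorization hne).mp h
    omega
end
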